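/- arXiv:1102.2493 — 6 statements merged into one kernel-verified Lean document; each statement's English description precedes it below -/
import Mathlib

section
/- Let K be an arbitrary field and H a maximal linear subspace of M_n(K) with a trivial spectrum. Then there exist positive integers n_1,…,n_p with n_1+⋯+n_p = n and linear subspaces V_k ⊆ M_{n_k}(K) (1 ≤ k ≤ p), each an irreducible maximal subspace with a trivial spectrum, such that H is similar to V_1 ∨ V_2 ∨ ⋯ ∨ V_p. -/
open Matrix

/-- A linear subspace of matrices has a trivial spectrum if no matrix of it
possesses a non-zero invariant vector. -/
def TrivialSpectrum {K : Type*} [Field K] {n : ℕ} (V : Set (Matrix (Fin n) (Fin n) K)) : Prop :=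
  ∀ M ∈ V, ∀ X : Fin n → K, M.mulVec X = X → X = 0

/-- A subspace of `M_n(K)` is irreducible if the only subspaces of `K^n` invariant under
every matrix of it are `⊥` and `⊤`. -/
def IrreducibleMatSpace {K : Type*} [Field K] {n : ℕ}
    (V : Set (Matrix (Fin n) (Fin n) K)) : Prop :=
  ∀ W : Submodule K (Fin n → K), (∀ M ∈ V, ∀ x ∈ W, M.mulVec x ∈ W) → W = ⊥ ∨ W = ⊤

/-- `V ∨ W`: block upper-triangular matrices with diagonal blocks in `V` and `W` and
arbitrary upper-right block. -/
def blockJoin {K : Type*} [Field K] {n p : ℕ}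
    (V : Set (Matrix (Fin n) (Fin n) K)) (W : Set (Matrix (Fin p) (Fin p) K)) :
    Set (Matrix (Fin (n + p)) (Fin (n + p)) K) :=
  {M | ∃ A ∈ V, ∃ C ∈ W, ∃ B : Matrix (Fin n) (Fin p) K,
    M = Matrix.reindex finSumFinEquiv finSumFinEquiv (Matrix.fromBlocks A B 0 C)}

/-- Sum of the sizes in a list of (size, subspace) pairs. -/
def sigSum {β : ℕ → Type*} : List (Σ m : ℕ, β m) → ℕ
  | [] => 0
  | x :: xs => x.1 + sigSum xs

/-- `V_1 ∨ ⋯ ∨ V_p` for a list of pairs `(n_k, V_k)` of sizes and subspaces. -/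
def bdSetSub {K : Type*} [Field K] :
    (l : List (Σ m : ℕ, Submodule K (Matrix (Fin m) (Fin m) K))) →
      Set (Matrix (Fin (sigSum l)) (Fin (sigSum l)) K)
  | [] => Set.univ
  | x :: xs => blockJoin (x.2 : Set (Matrix (Fin x.1) (Fin x.1) K)) (bdSetSub xs)

/-- Two subspaces of `M_n(K)` are similar if one is obtained from the other by conjugation. -/
def SimilarSets {K : Type*} [Field K] {n : ℕ}
    (V W : Set (Matrix (Fin n) (Fin n) K)) : Prop :=
  ∃ P : Matrix (Fin n) (Fin n) K, IsUnit P ∧ W = (fun M => P * M * P⁻¹) '' V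

open Module

/-- If every vertex of a nonempty finite digraph has an out-neighbour, then there is a nonempty set
of vertices in which every vertex has exactly one out-neighbour. -/
theorem exists_finset_existsUnique_rel {ι : Type*} [Fintype ι] [Nonempty ι] (r : ι → ι → Prop)
    (hr : ∀ i, ∃ j, r i j) :
    ∃ S : Finset ι, S.Nonempty ∧ ∀ i ∈ S, ∃ j ∈ S, r i j ∧ ∀ k ∈ S, r i k → k = j := by
  classical
  let good : Finset ι → Prop := fun S => S.Nonempty ∧ ∀ i ∈ S, ∃ j ∈ S, r i j
  have huniv : good Finset.univ :=
    ⟨Finset.univ_nonempty, fun i _ => (hr i).imp fun j hj => ⟨Finset.mem_univ j, hj⟩⟩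
  obtain ⟨S, -, hS⟩ := exists_minimal_le_of_wellFoundedLT good Finset.univ huniv
  obtain ⟨hne, hout⟩ := hS.prop
  have himage : ∀ f : ι → ι, (∀ i ∈ S, f i ∈ S ∧ r i (f i)) → S.image f = S := by
    intro f hf
    have hsub : S.image f ⊆ S := Finset.image_subset_iff.2 fun i hi => (hf i hi).1
    refine (hS.eq_of_le ⟨hne.image f, ?_⟩ hsub)
    intro i hi
    exact ⟨f i, Finset.mem_image_of_mem f (hsub hi), (hf i (hsub hi)).2⟩
  have hinj : ∀ f : ι → ι, (∀ i ∈ S, f i ∈ S ∧ r i (f i)) → Set.InjOn f S := fun f hf =>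
    Finset.card_image_iff.1 (by rw [himage f hf])
  refine ⟨S, hne, fun i hi => ?_⟩
  choose! f hfS hfr using hout
  have hf : ∀ i ∈ S, f i ∈ S ∧ r i (f i) := fun i hi => ⟨hfS i hi, hfr i hi⟩
  refine ⟨f i, hfS i hi, hfr i hi, fun k hk hik => ?_⟩
  by_contra hne'
  obtain ⟨m, hm, rfl⟩ := Finset.mem_image.1 ((himage f hf).symm ▸ hk)
  have hmi : m ≠ i := fun h => hne' (h ▸ rfl)
  have hg : ∀ a ∈ S, Function.update f i (f m) a ∈ S ∧ r a (Function.update f i (f m) a) := by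
    intro a ha
    by_cases hai : a = i
    · subst hai
      simpa using ⟨hk, hik⟩
    · simpa [hai] using hf a ha
  exact hmi (hinj _ hg hm hi (by simp [hmi]))

/-- For a subspace with a trivial spectrum, there is an index `i` such that the subspace contains no
nonzero matrix all of whose rows but the `i`-th vanish. -/
theorem TrivialSpectrum.exists_row {K : Type*} [Field K] {n : ℕ}
    {V : Submodule K (Matrix (Fin (n + 1)) (Fin (n + 1)) K)}
    (hV : TrivialSpectrum (V : Set (Matrix (Fin (n + 1)) (Fin (n + 1)) K))) :
    ∃ i, ∀ M ∈ V, (∀ j, j ≠ i → M j = 0) → M = 0 := by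
  by_contra! hcon
  choose E hEV hE hE0 using hcon
  have hrow : ∀ i, ∃ j, E i i j ≠ 0 := by
    intro i
    by_contra! h
    refine hE0 i ?_
    ext a b
    by_cases ha : a = i
    · subst ha
      exact h b
    · exact congrFun (hE i a ha) b
  obtain ⟨S, ⟨s, hs⟩, hS⟩ := exists_finset_existsUnique_rel _ hrow
  choose! f hfS hf huniq using hS
  let X : Fin (n + 1) → K := fun j => if j ∈ S then 1 else 0
  have hX : (∑ i ∈ S, (E i i (f i))⁻¹ • E i) *ᵥ X = X := by
    ext a
    have hsum : ∀ i ∈ S, (E i *ᵥ X) a = if a = i then E i i (f i) else 0 := by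
      intro i hi
      split_ifs with hai
      · subst hai
        have : (E a *ᵥ X) a = ∑ j, E a a j * X j := rfl
        rw [this, Finset.sum_eq_single (f a)]
        · simp [X, hfS a hi]
        · intro b _ hb
          by_cases hbS : b ∈ S
          · have : E a a b = 0 := by
              by_contra h
              exact hb (huniq a hi b hbS h)
            simp [this]
          · simp [X, hbS]
        · simp
      · simp [Matrix.mulVec, hE i a hai]
    rw [Matrix.sum_mulVec, Finset.sum_apply]
    have : ∀ i ∈ S, (((E i i (f i))⁻¹ • E i) *ᵥ X) a = if a = i then 1 else 0 := by
      intro i hi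
      rw [Matrix.smul_mulVec, Pi.smul_apply, hsum i hi]
      split_ifs
      · simp [hf i hi]
      · simp
    rw [Finset.sum_congr rfl this]
    simp [X]
  have hzero := hV _ (V.sum_mem fun i _ => V.smul_mem _ (hEV i)) X hX
  simpa [X, hs] using congrFun hzero s

theorem TrivialSpectrum.finrank_le {K : Type*} [Field K] {n : ℕ}
    {V : Submodule K (Matrix (Fin n) (Fin n) K)}
    (hV : TrivialSpectrum (V : Set (Matrix (Fin n) (Fin n) K))) :
    finrank K V ≤ n * (n - 1) / 2 := by
  induction n with
  | zero => simp [finrank_zero_of_subsingleton]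
  | succ n ih =>
    obtain ⟨i, hi⟩ := hV.exists_row
    let f : V →ₗ[K] (Fin (n + 1) → K) :=
      { toFun := fun M j => M.1 j i
        map_add' := fun _ _ => rfl
        map_smul' := fun _ _ => rfl }
    let g : LinearMap.ker f →ₗ[K] Matrix (Fin n) (Fin n) K :=
      { toFun := fun M => M.1.1.submatrix i.succAbove i.succAbove
        map_add' := fun _ _ => rfl
        map_smul' := fun _ _ => rfl }
    have hcol : ∀ M : LinearMap.ker f, ∀ j, M.1.1 j i = 0 := fun M j => congrFun M.2 j
    have hf : finrank K (LinearMap.range f) < n + 1 := by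
      have : LinearMap.range f ≠ ⊤ := by
        intro htop
        obtain ⟨M, hM⟩ := (htop ▸ Submodule.mem_top :
          Pi.single i (1 : K) ∈ LinearMap.range f)
        have := hV M.1 M.2 (Pi.single i 1) (by rw [Matrix.mulVec_single_one]; exact hM)
        simpa using congrFun this i
      simpa using Submodule.finrank_lt this
    have hg : Function.Injective g := by
      intro M N hMN
      have : M.1.1 - N.1.1 = 0 := by
        refine hi _ (V.sub_mem M.1.2 N.1.2) fun j hj => ?_
        obtain ⟨a, rfl⟩ := Fin.exists_succAbove_eq hj
        ext k
        rcases Fin.eq_self_or_eq_succAbove i k with rfl | ⟨b, rfl⟩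
        · simp [hcol]
        · exact sub_eq_zero.2 (congrFun (congrFun hMN a) b)
      exact Subtype.ext (Subtype.ext (sub_eq_zero.1 this))
    have htriv : TrivialSpectrum (LinearMap.range g : Set (Matrix (Fin n) (Fin n) K)) := by
      rintro _ ⟨M, rfl⟩ X hX
      let a : K := ∑ b, M.1.1 i (i.succAbove b) * X b
      have hfix : M.1.1 *ᵥ (i.insertNth a X) = i.insertNth a X := by
        ext j
        have hexp : (M.1.1 *ᵥ (i.insertNth a X : Fin (n + 1) → K)) j =
            ∑ b, M.1.1 j (i.succAbove b) * X b := by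
          rw [Matrix.mulVec, dotProduct, Fin.sum_univ_succAbove _ i]
          simp [hcol M j]
        rw [hexp]
        rcases Fin.eq_self_or_eq_succAbove i j with rfl | ⟨c, rfl⟩
        · simp [a]
        · rw [Fin.insertNth_apply_succAbove]
          exact congrFun hX c
      have hzero := hV M.1.1 M.1.2 _ hfix
      ext b
      simpa using congrFun hzero (i.succAbove b)
    have h1 := LinearMap.finrank_range_add_finrank_ker f
    have h2 := LinearMap.finrank_range_of_inj hg
    have h3 := ih htriv
    have h4 : (n + 1) * (n + 1 - 1) / 2 = n * (n - 1) / 2 + n := by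
      rw [← Nat.choose_two_right, ← Nat.choose_two_right, Nat.choose_succ_succ' n 1]
      simp [add_comm]
    omega

/-- A subspace of `K ^ (p + q)` of dimension `p` is spanned by the first `p` vectors of some basis,
given as the columns of an invertible matrix. -/
theorem Submodule.exists_isUnit_matrix {K : Type*} [Field K] {p q : ℕ}
    (W : Submodule K (Fin (p + q) → K)) (hW : finrank K W = p) :
    ∃ P : Matrix (Fin (p + q)) (Fin (p + q)) K, IsUnit P ∧
      ∀ x : Fin p ⊕ Fin q → K, P *ᵥ (x ∘ finSumFinEquiv.symm) ∈ W ↔ ∀ j, x (Sum.inr j) = 0 := by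
  obtain ⟨W', hc⟩ := W.exists_isCompl
  have hW' : finrank K W' = q := by
    have := Submodule.finrank_add_eq_of_isCompl hc
    simp at this
    omega
  let b₁ := finBasisOfFinrankEq K W hW
  let b₂ := finBasisOfFinrankEq K W' hW'
  let φ : (Fin (p + q) → K) ≃ₗ[K] (Fin (p + q) → K) :=
    (LinearEquiv.funCongrLeft K K finSumFinEquiv).trans
      ((b₁.prod b₂).equivFun.symm.trans (Submodule.prodEquivOfIsCompl W W' hc))
  refine ⟨LinearMap.toMatrix' φ.toLinearMap, ?_, fun x => ?_⟩
  · have := LinearMap.isUnit_toMatrix'_iff (f := φ.toLinearMap)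
    exact this.2 ((Module.End.isUnit_iff _).2 φ.bijective)
  · rw [LinearMap.toMatrix'_mulVec]
    have hφ : φ (x ∘ finSumFinEquiv.symm) =
        Submodule.prodEquivOfIsCompl W W' hc ((b₁.prod b₂).equivFun.symm x) := by
      simp only [φ, LinearEquiv.trans_apply]
      congr 2
      ext k
      simp [LinearEquiv.funCongrLeft, LinearMap.funLeft]
    change φ (x ∘ finSumFinEquiv.symm) ∈ W ↔ _
    rw [hφ, ← Submodule.prodEquivOfIsCompl_symm_apply_snd_eq_zero W W' hc,
      LinearEquiv.symm_apply_apply, ← b₂.repr.map_eq_zero_iff, Finsupp.ext_iff]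
    refine forall_congr' fun j => ?_
    have : x (Sum.inr j) = (b₁.prod b₂).repr ((b₁.prod b₂).equivFun.symm x) (Sum.inr j) := by
      rw [← Basis.equivFun_apply, LinearEquiv.apply_symm_apply]
    rw [this, Basis.prod_repr_inr]
    simp

/-- If a block upper-triangular matrix has no nonzero fixed vector, then neither have its diagonal
blocks. -/
theorem eq_zero_of_fromBlocks_zero₂₁_of_fixed {K : Type*} [Field K] {p q : ℕ}
    {A : Matrix (Fin p) (Fin p) K} {B : Matrix (Fin p) (Fin q) K} {C : Matrix (Fin q) (Fin q) K}
    (h : ∀ x, fromBlocks A B 0 C *ᵥ x = x → x = 0) :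
    (∀ X, A *ᵥ X = X → X = 0) ∧ ∀ X, C *ᵥ X = X → X = 0 := by
  have hA : ∀ X, A *ᵥ X = X → X = 0 := by
    intro X hX
    have := h (Sum.elim X 0) (by rw [fromBlocks_mulVec]; simp [hX])
    ext i
    simpa using congrFun this (Sum.inl i)
  refine ⟨hA, fun X hX => ?_⟩
  have hinj : Function.Injective
      (LinearMap.id - Matrix.mulVecLin A : (Fin p → K) →ₗ[K] (Fin p → K)) := by
    refine (injective_iff_map_eq_zero _).2 fun Y hY => hA Y ?_
    have : Y - A *ᵥ Y = 0 := by simpa using hY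
    exact (sub_eq_zero.1 this).symm
  obtain ⟨Y, hY⟩ := LinearMap.injective_iff_surjective.1 hinj (B *ᵥ X)
  have hY' : Y - A *ᵥ Y = B *ᵥ X := by simpa using hY
  have := h (Sum.elim Y X) (by rw [fromBlocks_mulVec]; simp [hX, ← hY'])
  ext i
  simpa using congrFun this (Sum.inr i)

/-- A maximal subspace with a trivial spectrum which has an invariant subspace of dimension `p`
decomposes as a join of two maximal subspaces with a trivial spectrum. The first block describes
the action on the invariant subspace, hence is irreducible if that subspace is minimal. -/
theorem TrivialSpectrum.exists_blockJoin {K : Type*} [Field K] {p q : ℕ}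
    {H : Submodule K (Matrix (Fin (p + q)) (Fin (p + q)) K)}
    (htriv : TrivialSpectrum (H : Set (Matrix (Fin (p + q)) (Fin (p + q)) K)))
    (hdim : finrank K H = (p + q) * (p + q - 1) / 2)
    {W : Submodule K (Fin (p + q) → K)} (hWp : finrank K W = p)
    (hW : ∀ M ∈ H, ∀ x ∈ W, M *ᵥ x ∈ W)
    (hmin : ∀ U ≤ W, (∀ M ∈ H, ∀ x ∈ U, M *ᵥ x ∈ U) → U = ⊥ ∨ U = W) :
    ∃ (V₁ : Submodule K (Matrix (Fin p) (Fin p) K)) (V₂ : Submodule K (Matrix (Fin q) (Fin q) K)),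
      TrivialSpectrum (V₁ : Set (Matrix (Fin p) (Fin p) K)) ∧
      TrivialSpectrum (V₂ : Set (Matrix (Fin q) (Fin q) K)) ∧
      finrank K V₁ = p * (p - 1) / 2 ∧ finrank K V₂ = q * (q - 1) / 2 ∧
      IrreducibleMatSpace (V₁ : Set (Matrix (Fin p) (Fin p) K)) ∧
      SimilarSets (blockJoin (V₁ : Set (Matrix (Fin p) (Fin p) K))
        (V₂ : Set (Matrix (Fin q) (Fin q) K)))
        (H : Set (Matrix (Fin (p + q)) (Fin (p + q)) K)) := by
  obtain ⟨P, hP, hPW⟩ := W.exists_isUnit_matrix hWp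
  have hPdet : IsUnit P.det := (Matrix.isUnit_iff_isUnit_det P).1 hP
  have hPinj : Function.Injective P.mulVec := Matrix.mulVec_injective_iff_isUnit.2 hP
  let T : H →ₗ[K] Matrix (Fin p ⊕ Fin q) (Fin p ⊕ Fin q) K :=
    { toFun := fun M => (P⁻¹ * M.1 * P).submatrix finSumFinEquiv finSumFinEquiv
      map_add' := fun M N => by simp [mul_add, add_mul, Matrix.submatrix_add]
      map_smul' := fun c M => by simp [Matrix.submatrix_smul] }
  have hTM : ∀ M : H, P * Matrix.reindex finSumFinEquiv finSumFinEquiv (T M) * P⁻¹ = M.1 := by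
    intro M
    have : Matrix.reindex finSumFinEquiv finSumFinEquiv (T M) = P⁻¹ * M.1 * P := by
      simp [T]
    rw [this, Matrix.mul_assoc P⁻¹, Matrix.mul_nonsing_inv_cancel_left _ _ hPdet,
      Matrix.mul_nonsing_inv_cancel_right _ _ hPdet]
  have hTv : ∀ (M : H) (x : Fin p ⊕ Fin q → K),
      M.1 *ᵥ (P *ᵥ (x ∘ finSumFinEquiv.symm)) = P *ᵥ ((T M *ᵥ x) ∘ finSumFinEquiv.symm) := by
    intro M x
    have : (T M *ᵥ x) ∘ finSumFinEquiv.symm = (P⁻¹ * M.1 * P) *ᵥ (x ∘ finSumFinEquiv.symm) := by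
      change ((P⁻¹ * M.1 * P).submatrix finSumFinEquiv finSumFinEquiv *ᵥ x) ∘ _ = _
      rw [Matrix.submatrix_mulVec_equiv]
      ext
      simp
    rw [this, Matrix.mulVec_mulVec, Matrix.mulVec_mulVec, Matrix.mul_assoc,
      Matrix.mul_nonsing_inv_cancel_left _ _ hPdet]
  have hTinj : Function.Injective T := by
    intro M N h
    exact Subtype.ext (by rw [← hTM M, h, hTM N])
  have hTblocks : ∀ M : H,
      T M = fromBlocks (T M).toBlocks₁₁ (T M).toBlocks₁₂ 0 (T M).toBlocks₂₂ := by
    intro M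
    have : (T M).toBlocks₂₁ = 0 := by
      ext j i
      have hmem : P *ᵥ ((Pi.single (Sum.inl i) 1 : Fin p ⊕ Fin q → K) ∘ finSumFinEquiv.symm) ∈ W :=
        (hPW _).2 fun j => by simp
      have := hW M.1 M.2 _ hmem
      rw [hTv, hPW] at this
      simpa [Matrix.toBlocks₂₁] using this j
    rw [← this, Matrix.fromBlocks_toBlocks]
  have hTfix : ∀ (M : H) x, T M *ᵥ x = x → x = 0 := by
    intro M x hx
    have h0 := htriv M.1 M.2 _ ((hTv M x).trans (by rw [hx]))
    have h1 : x ∘ finSumFinEquiv.symm = 0 := hPinj (h0.trans (Matrix.mulVec_zero P).symm)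
    ext k
    simpa using congrFun h1 (finSumFinEquiv k)
  let T₁ : H →ₗ[K] Matrix (Fin p) (Fin p) K :=
    { toFun := fun M => (T M).toBlocks₁₁
      map_add' := fun M N => by rw [map_add]; rfl
      map_smul' := fun c M => by rw [map_smul]; rfl }
  let T₂ : H →ₗ[K] Matrix (Fin q) (Fin q) K :=
    { toFun := fun M => (T M).toBlocks₂₂
      map_add' := fun M N => by rw [map_add]; rfl
      map_smul' := fun c M => by rw [map_smul]; rfl }
  let T₁₂ : H →ₗ[K] Matrix (Fin p) (Fin q) K :=
    { toFun := fun M => (T M).toBlocks₁₂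
      map_add' := fun M N => by rw [map_add]; rfl
      map_smul' := fun c M => by rw [map_smul]; rfl }
  have hT : ∀ M : H, T M = fromBlocks (T₁ M) (T₁₂ M) 0 (T₂ M) := hTblocks
  have htriv₁ : TrivialSpectrum (LinearMap.range T₁ : Set (Matrix (Fin p) (Fin p) K)) := by
    rintro _ ⟨M, rfl⟩
    exact (eq_zero_of_fromBlocks_zero₂₁_of_fixed (hT M ▸ hTfix M)).1
  have htriv₂ : TrivialSpectrum (LinearMap.range T₂ : Set (Matrix (Fin q) (Fin q) K)) := by
    rintro _ ⟨M, rfl⟩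
    exact (eq_zero_of_fromBlocks_zero₂₁_of_fixed (hT M ▸ hTfix M)).2
  let Θ : H →ₗ[K] LinearMap.range T₁ × LinearMap.range T₂ × Matrix (Fin p) (Fin q) K :=
    T₁.rangeRestrict.prod (T₂.rangeRestrict.prod T₁₂)
  have hΘinj : Function.Injective Θ := by
    intro M N h
    apply hTinj
    have h1 : T₁ M = T₁ N := congrArg (fun z => z.1.1) h
    have h2 : T₂ M = T₂ N := congrArg (fun z => z.2.1.1) h
    have h3 : T₁₂ M = T₁₂ N := congrArg (fun z => z.2.2) h
    rw [hT M, hT N, h1, h2, h3]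
  have hle := LinearMap.finrank_le_finrank_of_injective hΘinj
  have htarget : finrank K (LinearMap.range T₁ × LinearMap.range T₂ × Matrix (Fin p) (Fin q) K) =
      finrank K (LinearMap.range T₁) + (finrank K (LinearMap.range T₂) + p * q) := by
    rw [finrank_prod, finrank_prod, finrank_matrix]
    simp
  have hsum : (p + q) * (p + q - 1) / 2 = p * (p - 1) / 2 + q * (q - 1) / 2 + p * q := by
    simp only [← Nat.choose_two_right]
    clear * -
    induction q with
    | zero => simp
    | succ q ih =>
      rw [← add_assoc, Nat.choose_succ_succ' (p + q), Nat.choose_succ_succ' q, ih]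
      simp only [Nat.choose_one_right]
      ring
  have hle₁ := htriv₁.finrank_le
  have hle₂ := htriv₂.finrank_le
  have hΘsurj : Function.Surjective Θ :=
    (LinearMap.injective_iff_surjective_of_finrank_eq_finrank (by omega)).1 hΘinj
  refine ⟨LinearMap.range T₁, LinearMap.range T₂, htriv₁, htriv₂, by omega, by omega, ?_, P, hP, ?_⟩
  · intro U hU
    let ι : (Fin p → K) →ₗ[K] (Fin (p + q) → K) :=
      { toFun := fun u => P *ᵥ ((Sum.elim u 0 : Fin p ⊕ Fin q → K) ∘ finSumFinEquiv.symm)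
        map_add' := fun u v => by
          rw [← Matrix.mulVec_add]
          congr 1
          ext k
          rcases h : finSumFinEquiv.symm k with a | a <;> simp [h]
        map_smul' := fun c u => by
          rw [← Matrix.mulVec_smul]
          congr 1
          ext k
          rcases h : finSumFinEquiv.symm k with a | a <;> simp [h] }
    have hιinj : Function.Injective ι := by
      intro u v huv
      have h1 := hPinj huv
      ext a
      simpa using congrFun h1 (finSumFinEquiv (Sum.inl a))
    have hιW : LinearMap.range ι = W := by
      refine Submodule.eq_of_le_of_finrank_eq ?_ ?_
      · rintro _ ⟨u, rfl⟩
        exact (hPW _).2 fun j => rfl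
      · rw [LinearMap.finrank_range_of_inj hιinj, hWp]
        simp
    have hιM : ∀ (M : H) u, M.1 *ᵥ ι u = ι (T₁ M *ᵥ u) := by
      intro M u
      refine (hTv M _).trans ?_
      rw [hT M, fromBlocks_mulVec]
      simp [ι]
    rcases hmin (U.map ι) (hιW ▸ LinearMap.map_le_range) (by
        rintro M hM _ ⟨u, hu, rfl⟩
        exact ⟨_, hU _ ⟨⟨M, hM⟩, rfl⟩ u hu, (hιM ⟨M, hM⟩ u).symm⟩) with h | h
    · left
      exact Submodule.map_injective_of_injective hιinj (h.trans (Submodule.map_bot ι).symm)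
    · right
      rw [← hιW, LinearMap.range_eq_map] at h
      exact Submodule.map_injective_of_injective hιinj h
  · ext M
    constructor
    · intro hM
      exact ⟨_, ⟨T₁ ⟨M, hM⟩, ⟨_, rfl⟩, T₂ ⟨M, hM⟩, ⟨_, rfl⟩, T₁₂ ⟨M, hM⟩, rfl⟩,
        by simp only [← hT]; exact hTM _⟩
    · rintro ⟨_, ⟨A, hA, C, hC, B, rfl⟩, rfl⟩
      obtain ⟨M, hM⟩ := hΘsurj (⟨A, hA⟩, ⟨C, hC⟩, B)
      have h1 : T₁ M = A := congrArg (fun z => z.1.1) hM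
      have h2 : T₂ M = C := congrArg (fun z => z.2.1.1) hM
      have h3 : T₁₂ M = B := congrArg (fun z => z.2.2) hM
      have := hTM M
      rw [hT, h1, h2, h3] at this
      simp only [this]
      exact M.2

/-- Conjugating the lower-right blocks does not change the similarity class of a join. -/
theorem SimilarSets.blockJoin {K : Type*} [Field K] {p q : ℕ}
    (V : Set (Matrix (Fin p) (Fin p) K)) {W W' : Set (Matrix (Fin q) (Fin q) K)}
    (h : SimilarSets W W') : SimilarSets (blockJoin V W) (blockJoin V W') := by
  obtain ⟨Q, hQ, rfl⟩ := h
  have hQdet : IsUnit Q.det := (Matrix.isUnit_iff_isUnit_det Q).1 hQ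
  let e := @finSumFinEquiv p q
  let R : Matrix (Fin p ⊕ Fin q) (Fin p ⊕ Fin q) K → Matrix (Fin (p + q)) (Fin (p + q)) K :=
    Matrix.reindex e e
  have hRmul : ∀ M N, R M * R N = R (M * N) := fun M N => by simp [R, Matrix.submatrix_mul_equiv]
  have hR1 : R 1 = 1 := by simp [R]
  have hD : R (fromBlocks 1 0 0 Q) * R (fromBlocks 1 0 0 Q⁻¹) = 1 := by
    rw [hRmul, Matrix.fromBlocks_multiply, ← hR1, ← Matrix.fromBlocks_one]
    simp [Matrix.mul_nonsing_inv _ hQdet]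
  have hconj : ∀ A (B : Matrix (Fin p) (Fin q) K) C,
      R (fromBlocks 1 0 0 Q) * R (fromBlocks A B 0 C) * (R (fromBlocks 1 0 0 Q))⁻¹ =
        R (fromBlocks A (B * Q⁻¹) 0 (Q * C * Q⁻¹)) := by
    intro A B C
    rw [Matrix.inv_eq_right_inv hD, hRmul, hRmul, Matrix.fromBlocks_multiply,
      Matrix.fromBlocks_multiply]
    simp
  refine ⟨R (fromBlocks 1 0 0 Q), (Matrix.isUnit_iff_isUnit_det _).2
    (Matrix.isUnit_det_of_right_inverse hD), ?_⟩
  ext M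
  constructor
  · rintro ⟨A, hA, _, ⟨C, hC, rfl⟩, B, rfl⟩
    refine ⟨_, ⟨A, hA, C, hC, B * Q, rfl⟩, (hconj _ _ _).trans ?_⟩
    rw [Matrix.mul_nonsing_inv_cancel_right _ _ hQdet]
  · rintro ⟨_, ⟨A, hA, C, hC, B, rfl⟩, rfl⟩
    exact ⟨A, hA, _, ⟨C, hC, rfl⟩, B * Q⁻¹, hconj _ _ _⟩

theorem SimilarSets.trans {K : Type*} [Field K] {n : ℕ} {U V W : Set (Matrix (Fin n) (Fin n) K)}
    (h₁ : SimilarSets U V) (h₂ : SimilarSets V W) : SimilarSets U W := by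
  obtain ⟨P, hP, rfl⟩ := h₁
  obtain ⟨Q, hQ, rfl⟩ := h₂
  refine ⟨Q * P, hQ.mul hP, ?_⟩
  rw [Set.image_image]
  refine Set.image_congr fun M _ => ?_
  rw [Matrix.mul_inv_rev]
  simp only [Matrix.mul_assoc]

/-- A set of matrices acting on a nonzero space has a minimal nonzero invariant subspace. -/
theorem exists_minimal_invariant_submodule {K : Type*} [Field K] {n : ℕ} (hn : 0 < n)
    (H : Set (Matrix (Fin n) (Fin n) K)) :
    ∃ W : Submodule K (Fin n → K), W ≠ ⊥ ∧ (∀ M ∈ H, ∀ x ∈ W, M *ᵥ x ∈ W) ∧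
      ∀ U ≤ W, (∀ M ∈ H, ∀ x ∈ U, M *ᵥ x ∈ U) → U = ⊥ ∨ U = W := by
  let good : Submodule K (Fin n → K) → Prop := fun W => W ≠ ⊥ ∧ ∀ M ∈ H, ∀ x ∈ W, M *ᵥ x ∈ W
  have : Nonempty (Fin n) := ⟨⟨0, hn⟩⟩
  have htop : good ⊤ := ⟨top_ne_bot, fun _ _ _ _ => Submodule.mem_top⟩
  obtain ⟨W, -, hW⟩ := exists_minimal_le_of_wellFoundedLT good ⊤ htop
  refine ⟨W, hW.prop.1, hW.prop.2, fun U hUW hU => or_iff_not_imp_left.2 fun hne => ?_⟩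
  exact hW.eq_of_le ⟨hne, hU⟩ hUW

theorem reindex_finCongr_image {α : Type*} {m : ℕ} (h : m = m)
    (S : Set (Matrix (Fin m) (Fin m) α)) :
    Matrix.reindex (finCongr h) (finCongr h) '' S = S := by
  ext M
  simp

/-- Every maximal linear subspace `H` of `M_n(K)` with a trivial spectrum is similar to
`V_1 ∨ V_2 ∨ ⋯ ∨ V_p` for some irreducible maximal linear subspaces `V_k ⊆ M_{n_k}(K)`
with trivial spectra, where `n_1 + ⋯ + n_p = n`. -/
theorem decomposition_into_irreducibles (K : Type*) [Field K] (n : ℕ)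
    (H : Submodule K (Matrix (Fin n) (Fin n) K))
    (htriv : TrivialSpectrum (H : Set (Matrix (Fin n) (Fin n) K)))
    (hdim : Module.finrank K H = n * (n - 1) / 2) :
    ∃ l : List (Σ m : ℕ, Submodule K (Matrix (Fin m) (Fin m) K)),
      (∀ x ∈ l, 0 < x.1 ∧
        TrivialSpectrum (x.2 : Set (Matrix (Fin x.1) (Fin x.1) K)) ∧
        Module.finrank K x.2 = x.1 * (x.1 - 1) / 2 ∧
        IrreducibleMatSpace (x.2 : Set (Matrix (Fin x.1) (Fin x.1) K))) ∧
      ∃ h : sigSum l = n,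
        SimilarSets ((Matrix.reindex (finCongr h) (finCongr h)) '' bdSetSub l)
          (H : Set (Matrix (Fin n) (Fin n) K)) := by
  induction n using Nat.strong_induction_on with
  | _ n ih =>
    rcases Nat.eq_zero_or_pos n with rfl | hn
    · refine ⟨[], by simp, rfl, 1, isUnit_one, ?_⟩
      ext M
      refine iff_of_true ?_ ⟨M, ⟨M, trivial, Subsingleton.elim _ _⟩, Subsingleton.elim _ _⟩
      rw [Subsingleton.elim M 0]
      exact H.zero_mem
    · obtain ⟨W, hne, hW, hmin⟩ := exists_minimal_invariant_submodule hn
        (H : Set (Matrix (Fin n) (Fin n) K))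
      obtain ⟨p, hWp⟩ : ∃ p, finrank K W = p := ⟨_, rfl⟩
      have hp : 0 < p := by
        have := Submodule.one_le_finrank_iff.2 hne
        omega
      obtain ⟨q, rfl⟩ : ∃ q, n = p + q := by
        refine Nat.exists_eq_add_of_le ?_
        simpa [hWp] using W.finrank_le
      obtain ⟨V₁, V₂, ht₁, ht₂, hd₁, hd₂, hirr, hsim⟩ :=
        htriv.exists_blockJoin hdim hWp hW hmin
      obtain ⟨l, hl, hq, hsim₂⟩ := ih q (by omega) V₂ ht₂ hd₂
      subst hq
      rw [reindex_finCongr_image] at hsim₂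
      refine ⟨⟨p, V₁⟩ :: l, ?_, rfl, ?_⟩
      · intro x hx
        rcases List.mem_cons.1 hx with rfl | hx
        · exact ⟨hp, ht₁, hd₁, hirr⟩
        · exact hl x hx
      · have hid := reindex_finCongr_image rfl (bdSetSub (⟨p, V₁⟩ :: l))
        have hcons : SimilarSets (bdSetSub (⟨p, V₁⟩ :: l))
            (H : Set (Matrix (Fin (p + sigSum l)) (Fin (p + sigSum l)) K)) :=
          (hsim₂.blockJoin _).trans hsim
        exact (congrArg (fun S => SimilarSets S
          (H : Set (Matrix (Fin (p + sigSum l)) (Fin (p + sigSum l)) K))) hid).mpr hcons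
end

section
/- Let K be a field, n a positive integer, and X ∈ K^n a non-zero vector. Then {AX : A ∈ Alt_n(K)} = {Y ∈ K^n : X^T Y = 0}, the orthogonal hyperplane of X for the standard bilinear form (X,Y) ↦ X^T Y; in particular this subspace has dimension n−1. -/
open Matrix

/-- The set of alternate matrices: those `A` with `Xᵀ A X = 0` for all `X`. -/
def altSet (K : Type*) [Field K] (n : ℕ) : Set (Matrix (Fin n) (Fin n) K) :=
  {A | ∀ X : Fin n → K, X ⬝ᵥ A.mulVec X = 0}

/-- The matrix of `Z ↦ (W ⬝ᵥ Z) Y - (Y ⬝ᵥ Z) W` is alternate. -/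
theorem vecMulVec_sub_vecMulVec_mem_altSet {K : Type*} [Field K] {n : ℕ} (Y W : Fin n → K) :
    vecMulVec Y W - vecMulVec W Y ∈ altSet K n := by
  intro Z
  simp only [sub_mulVec, vecMulVec_mulVec, dotProduct_sub, op_smul_eq_smul, dotProduct_smul,
    smul_eq_mul]
  rw [dotProduct_comm Z Y, dotProduct_comm Z W]
  ring

/-- The image of a non-zero vector under the alternate matrices is its orthogonal. -/
theorem setOf_altSet_mulVec_eq {K : Type*} [Field K] {n : ℕ} {X : Fin n → K} (hX : X ≠ 0) :
    {Y : Fin n → K | ∃ A ∈ altSet K n, A.mulVec X = Y} = {Y : Fin n → K | X ⬝ᵥ Y = 0} := by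
  ext Y
  constructor
  · rintro ⟨A, hA, rfl⟩
    exact hA X
  · intro hY
    obtain ⟨i, hi⟩ := Function.ne_iff.mp hX
    have hi : X i ≠ 0 := hi
    refine ⟨_, vecMulVec_sub_vecMulVec_mem_altSet Y (Pi.single i (X i)⁻¹), ?_⟩
    have hY : Y ⬝ᵥ X = 0 := (dotProduct_comm Y X).trans hY
    simp [sub_mulVec, vecMulVec_mulVec, hY, hi]

/-- The orthogonal of a non-zero vector is a hyperplane. -/
theorem finrank_ker_dotProductBilin {K : Type*} [Field K] {n : ℕ} {X : Fin n → K} (hX : X ≠ 0) :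
    Module.finrank K (LinearMap.ker (dotProductBilin K K X)) = n - 1 := by
  have hf : dotProductBilin K K X ≠ 0 := fun h =>
    hX (dotProduct_eq_zero X fun Y => LinearMap.congr_fun h Y)
  have h := Module.Dual.finrank_ker_add_one_of_ne_zero hf
  rw [Module.finrank_fin_fun] at h
  omega

/-- For any non-zero vector `X ∈ K^n`, one has `Alt_n(K) X = {X}^⊥`, and in particular
this subspace has dimension `n - 1`. -/
theorem altSet_mulVec_eq_hyperplane (K : Type*) [Field K] (n : ℕ) (hn : 0 < n)
    (X : Fin n → K) (hX : X ≠ 0) :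
    {Y : Fin n → K | ∃ A ∈ altSet K n, A.mulVec X = Y} = {Y : Fin n → K | X ⬝ᵥ Y = 0} ∧
    Module.finrank K
      (Submodule.span K {Y : Fin n → K | ∃ A ∈ altSet K n, A.mulVec X = Y}) = n - 1 := by
  refine ⟨setOf_altSet_mulVec_eq hX, ?_⟩
  rw [setOf_altSet_mulVec_eq hX, ← finrank_ker_dotProductBilin hX]
  have h : {Y : Fin n → K | X ⬝ᵥ Y = 0} = LinearMap.ker (dotProductBilin K K X) := rfl
  rw [h, Submodule.span_eq]
end

section
/- Let K be a field and P ∈ GL_n(K). Then the linear subspace P·Alt_n(K) = {PA : A ∈ Alt_n(K)} of M_n(K) has a trivial spectrum if and only if P is non-isotropic. -/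
open Matrix

/-- A matrix `P` is non-isotropic if `Xᵀ P X ≠ 0` for every non-zero `X`. -/
def nonIsotropic {K : Type*} [Field K] {n : ℕ} (P : Matrix (Fin n) (Fin n) K) : Prop :=
  ∀ X : Fin n → K, X ≠ 0 → X ⬝ᵥ P.mulVec X ≠ 0

/-- Any vector orthogonal to a non-zero vector `X` is the image of `X` under an alternate matrix. -/
theorem exists_mem_altSet_mulVec_eq {K : Type*} [Field K] {n : ℕ} {X Y : Fin n → K}
    (hX : X ≠ 0) (hXY : X ⬝ᵥ Y = 0) : ∃ A ∈ altSet K n, A *ᵥ X = Y := by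
  obtain ⟨i, hi⟩ := Function.ne_iff.mp hX
  let Z : Fin n → K := Pi.single i (X i)⁻¹
  have hZ : Z ⬝ᵥ X = 1 := by
    rw [single_dotProduct]
    exact inv_mul_cancel₀ hi
  refine ⟨vecMulVec Y Z - vecMulVec Z Y, fun W => ?_, ?_⟩
  · simp only [sub_mulVec, vecMulVec_mulVec, op_smul_eq_smul, dotProduct_sub, dotProduct_smul,
      smul_eq_mul]
    rw [dotProduct_comm W Y, dotProduct_comm W Z]
    ring
  · simp [sub_mulVec, vecMulVec_mulVec, hZ, dotProduct_comm Y X, hXY]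

/-- For invertible `P`, the subspace `P·Alt_n(K)` has a trivial spectrum if and only if
`P` is non-isotropic. -/
theorem pAlt_trivialSpectrum_iff_nonIsotropic (K : Type*) [Field K] (n : ℕ)
    (P : Matrix (Fin n) (Fin n) K) (hP : IsUnit P) :
    TrivialSpectrum ((fun A => P * A) '' altSet K n) ↔ nonIsotropic P := by
  constructor
  · intro h Y hY hYP
    have hX : P *ᵥ Y ≠ 0 := fun h0 =>
      hY (Matrix.mulVec_injective_of_isUnit hP (by rw [h0, Matrix.mulVec_zero]))
    obtain ⟨A, hA, hAX⟩ := exists_mem_altSet_mulVec_eq hX (by rwa [dotProduct_comm])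
    exact hX (h _ ⟨A, hA, rfl⟩ _ (by rw [← Matrix.mulVec_mulVec, hAX]))
  · rintro h _ ⟨A, hA, rfl⟩ X hX
    rw [← Matrix.mulVec_mulVec] at hX
    by_contra hX0
    refine h (A *ᵥ X) (fun h0 => hX0 ?_) ?_
    · rw [← hX, h0, Matrix.mulVec_zero]
    · rw [hX, dotProduct_comm]
      exact hA X
end

section
/- Let K be a field and P ∈ GL_n(K). Then P·Alt_n(K) = Alt_n(K) if and only if P is a scalar multiple of the identity matrix. -/
open Matrix

/-- The differences of matrix units `single i j 1 - single j i 1` are alternate. -/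
lemma single_sub_single_mem_altSet (K : Type*) [Field K] {n : ℕ} (i j : Fin n) :
    single i j (1 : K) - single j i 1 ∈ altSet K n := by
  intro X
  simp only [sub_mulVec, single_mulVec, one_mul, dotProduct_sub]
  change X ⬝ᵥ Pi.single i (X j) - X ⬝ᵥ Pi.single j (X i) = 0
  rw [dotProduct_single, dotProduct_single, mul_comm, sub_self]

lemma smul_mem_altSet {K : Type*} [Field K] {n : ℕ} (c : K) {A : Matrix (Fin n) (Fin n) K}
    (hA : A ∈ altSet K n) : c • A ∈ altSet K n := by
  intro X
  rw [smul_mulVec, dotProduct_smul, hA X, smul_zero]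

lemma diag_eq_zero_of_mem_altSet {K : Type*} [Field K] {n : ℕ} {A : Matrix (Fin n) (Fin n) K}
    (hA : A ∈ altSet K n) (i : Fin n) : A i i = 0 := by
  simpa using hA (Pi.single i 1)

lemma add_apply_swap_eq_zero_of_mem_altSet {K : Type*} [Field K] {n : ℕ}
    {A : Matrix (Fin n) (Fin n) K} (hA : A ∈ altSet K n) (i j : Fin n) :
    A i j + A j i = 0 := by
  have h := hA (Pi.single i 1 + Pi.single j 1)
  simp only [mulVec_add, dotProduct_add, add_dotProduct, single_one_dotProduct,
    mulVec_single_one, col_apply, diag_eq_zero_of_mem_altSet hA] at h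
  linear_combination h

/-- For invertible `P`, one has `P·Alt_n(K) = Alt_n(K)` if and only if `P` is a scalar
multiple of the identity matrix. -/
theorem pAlt_eq_alt_iff_scalar (K : Type*) [Field K] (n : ℕ)
    (P : Matrix (Fin n) (Fin n) K) (hP : IsUnit P) :
    (fun A => P * A) '' altSet K n = altSet K n ↔
      ∃ c : K, P = c • (1 : Matrix (Fin n) (Fin n) K) := by
  constructor
  · intro h
    have hmem (i j : Fin n) : P * (single i j (1 : K) - single j i 1) ∈ altSet K n :=
      h ▸ Set.mem_image_of_mem _ (single_sub_single_mem_altSet K i j)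
    have hoff (i j : Fin n) (hij : i ≠ j) : P i j = 0 := by
      simpa [mul_sub, hij, hij.symm] using diag_eq_zero_of_mem_altSet (hmem j i) i
    have hdiag (i j : Fin n) : P i i = P j j := by
      rcases eq_or_ne i j with rfl | hij
      · rfl
      · have := add_apply_swap_eq_zero_of_mem_altSet (hmem i j) i j
        simpa [mul_sub, hij, hij.symm, ← sub_eq_add_neg, sub_eq_zero] using this
    rcases isEmpty_or_nonempty (Fin n) with hn | ⟨⟨k⟩⟩
    · exact ⟨0, Subsingleton.elim _ _⟩
    · refine ⟨P k k, ext fun i j => ?_⟩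
      rcases eq_or_ne i j with rfl | hij
      · simp [hdiag i k]
      · simp [hij, hoff i j hij]
  · rintro ⟨c, rfl⟩
    ext A
    simp only [smul_mul_assoc, one_mul]
    constructor
    · rintro ⟨B, hB, rfl⟩
      exact smul_mem_altSet c hB
    · intro hA
      rcases eq_or_ne c 0 with rfl | hc
      · have : Subsingleton (Matrix (Fin n) (Fin n) K) :=
          subsingleton_of_zero_eq_one (isUnit_zero_iff.mp (by simpa using hP))
        exact ⟨A, hA, Subsingleton.elim _ _⟩
      · exact ⟨c⁻¹ • A, smul_mem_altSet _ hA, smul_inv_smul₀ hc A⟩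
end

section
/- (Gerstenhaber's theorem for |K| ≥ 3.) Let K be a field with at least three elements and V a linear subspace of M_n(K) such that dim V = n(n-1)/2 and every matrix of V is nilpotent. Then V is similar to NT_n(K), the space of strictly upper triangular matrices of M_n(K). -/
open Matrix

/-- The space `NT_n(K)` of strictly upper triangular matrices. -/
def strictUpperTriangularSet (K : Type*) [Field K] (n : ℕ) :
    Set (Matrix (Fin n) (Fin n) K) :=
  {M | ∀ i j : Fin n, j ≤ i → M i j = 0}

section Auxiliary

open Polynomial Module

theorem Matrix.charpolyRev_eq_one_of_isNilpotent {K n : Type*} [Field K] [Fintype n]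
    [DecidableEq n] {A : Matrix n n K} (hA : IsNilpotent A) : A.charpolyRev = 1 := by
  obtain ⟨r, -, hr⟩ := Polynomial.isUnit_iff.1 (Matrix.isUnit_charpolyRev_of_isNilpotent hA)
  have h := A.eval_charpolyRev
  rw [← hr, eval_C] at h
  rw [← hr, h, C_1]

/-- If `A + t P R` is nilpotent for all `t`, where `P R` has rank at most two, then the
`2 × 2` matrix of generating functions `∑ Xᵏ R Aᵏ P` has zero trace and zero determinant. -/
theorem Matrix.trace_det_coeff_eq_zero_of_isNilpotent {K n : Type*} [Field K]
    (hK : 3 ≤ Cardinal.mk K) [Fintype n] [DecidableEq n] (A : Matrix n n K)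
    (P : Matrix n (Fin 2) K) (R : Matrix (Fin 2) n K)
    (h : ∀ t : K, IsNilpotent (A + t • (P * R))) (k : ℕ) :
    (R * A ^ k * P) 0 0 + (R * A ^ k * P) 1 1 = 0 ∧
    ∑ ij ∈ Finset.HasAntidiagonal.antidiagonal k, ((R * A ^ ij.1 * P) 0 0 * (R * A ^ ij.2 * P) 1 1
      - (R * A ^ ij.1 * P) 0 1 * (R * A ^ ij.2 * P) 1 0) = 0 := by
  have hA : IsNilpotent A := by simpa using h 0
  obtain ⟨N, hN⟩ := hA
  set x : Matrix n n K[X] := (X : K[X]) • A.map C with hx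
  have hxk : ∀ k, x ^ k = (X ^ k : K[X]) • (A ^ k).map C := by
    intro k
    rw [hx, _root_.smul_pow]
    congr 1
    exact ((C : K →+* K[X]).mapMatrix.map_pow A k).symm
  have hxN : x ^ N = 0 := by
    rw [hxk, hN]; simp
  set S : Matrix n n K[X] := ∑ i ∈ Finset.range N, x ^ i with hS
  have hS1 : (1 - x) * S = 1 := by rw [hS, mul_neg_geom_sum, hxN, sub_zero]
  set P' : Matrix n (Fin 2) K[X] := P.map C with hP'
  set R' : Matrix (Fin 2) n K[X] := R.map C with hR'
  set T : Matrix (Fin 2) (Fin 2) K[X] := R' * S * P' with hT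
  have hdet : ∀ t : K, (1 - (X * C t) • T).det = 1 := by
    intro t
    have h1 := Matrix.charpolyRev_eq_one_of_isNilpotent (h t)
    have h0 : (1 - x).det = 1 := Matrix.charpolyRev_eq_one_of_isNilpotent ⟨N, hN⟩
    have h2 : 1 - (X : K[X]) • (A + t • (P * R)).map C
        = (1 - x) * (1 - (S * P') * ((X * C t) • R')) := by
      rw [mul_sub, mul_one, ← Matrix.mul_assoc, ← Matrix.mul_assoc, hS1, Matrix.one_mul, hx, hP',
        hR', Matrix.mul_smul, sub_sub]
      congr 1
      refine Matrix.ext fun i j => ?_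
      simp [mul_add, ← Matrix.map_mul]
      ring
    rw [Matrix.charpolyRev, h2, Matrix.det_mul, h0, one_mul, Matrix.det_one_sub_mul_comm,
      Matrix.smul_mul, ← Matrix.mul_assoc] at h1
    exact h1
  obtain ⟨t, ht0, ht1⟩ : ∃ t : K, t ≠ 0 ∧ t ≠ 1 := by
    obtain ⟨t, ht⟩ := Cardinal.exists_notMem_of_length_lt [0, 1]
      (lt_of_lt_of_le (by simp; norm_num) hK)
    exact ⟨t, by simpa [not_or] using ht⟩
  have key : ∀ t : K, t ≠ 0 →
      (T 0 0 + T 1 1) = C t * (X * (T 0 0 * T 1 1 - T 0 1 * T 1 0)) := by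
    intro t ht
    have h1 := hdet t
    rw [Matrix.det_fin_two] at h1
    simp at h1
    have hne : (X * C t : K[X]) ≠ 0 := mul_ne_zero X_ne_zero (C_ne_zero.2 ht)
    apply mul_left_cancel₀ hne
    linear_combination -h1
  have hdet0 : T 0 0 * T 1 1 - T 0 1 * T 1 0 = 0 := by
    have h1 := key 1 one_ne_zero
    rw [key t ht0] at h1
    have h2 : C (t - 1) * (X * (T 0 0 * T 1 1 - T 0 1 * T 1 0)) = 0 := by
      rw [C_sub]; linear_combination h1
    simpa [sub_eq_zero, ht1, X_ne_zero, C_eq_zero, ← C_1, C_inj, -map_one, -map_sub] using h2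
  have htr0 : T 0 0 + T 1 1 = 0 := by rw [key 1 one_ne_zero, hdet0]; simp
  have hcoeff : ∀ k i j, (T i j).coeff k = (R * A ^ k * P) i j := by
    intro k i j
    have h1 : T = ∑ m ∈ Finset.range N, (X ^ m : K[X]) • (R * A ^ m * P).map C := by
      rw [hT, hS, Matrix.mul_sum, Matrix.sum_mul]
      refine Finset.sum_congr rfl fun m _ => ?_
      rw [hxk, Matrix.mul_smul, Matrix.smul_mul, hR', hP', ← Matrix.map_mul, ← Matrix.map_mul]
    rw [h1]
    simp only [Matrix.sum_apply, Matrix.smul_apply, Matrix.map_apply, smul_eq_mul,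
      finsetSum_coeff, coeff_X_pow_mul', coeff_C]
    by_cases hk : k < N
    · rw [Finset.sum_eq_single k]
      · simp
      · intro m _ hm
        split_ifs <;> first | rfl | omega
      · intro hm; simp at hm; omega
    · have : A ^ k = 0 := pow_eq_zero_of_le (not_lt.1 hk) hN
      rw [this]
      simp only [Matrix.mul_zero, Matrix.zero_mul, Matrix.zero_apply]
      refine Finset.sum_eq_zero fun m hm => ?_
      simp at hm
      split_ifs <;> first | rfl | omega
  constructor
  · rw [← hcoeff, ← hcoeff, ← coeff_add, htr0, coeff_zero]
  · have h1 := congrArg (fun p => p.coeff k) hdet0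
    simp only [coeff_sub, coeff_mul, hcoeff, coeff_zero, ← Finset.sum_sub_distrib] at h1
    exact h1

theorem Module.End.rank_two_of_isNilpotent {K E : Type*} [Field K]
    (hK : 3 ≤ Cardinal.mk K) [AddCommGroup E] [Module K E] [FiniteDimensional K E]
    (A : End K E) (p q : E) (φ ψ : Dual K E)
    (h : ∀ t : K, IsNilpotent (A + t • (φ.smulRight p + ψ.smulRight q))) (k : ℕ) :
    φ ((A ^ k) p) + ψ ((A ^ k) q) = 0 ∧
    ∑ ij ∈ Finset.HasAntidiagonal.antidiagonal k, (φ ((A ^ ij.1) p) * ψ ((A ^ ij.2) q)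
      - φ ((A ^ ij.1) q) * ψ ((A ^ ij.2) p)) = 0 := by
  let b := finBasis K E
  let c := Pi.basisFun K (Fin 2)
  let P : (Fin 2 → K) →ₗ[K] E := Fintype.linearCombination K ![p, q]
  let R : E →ₗ[K] (Fin 2 → K) := LinearMap.pi ![φ, ψ]
  have hPR : P ∘ₗ R = φ.smulRight p + ψ.smulRight q := by
    ext v; simp [P, R, Fintype.linearCombination_apply]
  have hT : ∀ (k : ℕ) (i j : Fin 2), (LinearMap.toMatrix b c R * (LinearMap.toMatrix b b A) ^ k *
      LinearMap.toMatrix c b P) i j = ![φ, ψ] i ((A ^ k) (![p, q] j)) := by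
    intro k i j
    have h1 : LinearMap.toMatrix b c R * (LinearMap.toMatrix b b) A ^ k *
        LinearMap.toMatrix c b P = LinearMap.toMatrix c c ((R ∘ₗ (A ^ k)) ∘ₗ P) := by
      rw [LinearMap.toMatrix_comp c b c, LinearMap.toMatrix_comp b b c, LinearMap.toMatrix_pow]
    rw [h1, LinearMap.toMatrix_apply]
    simp [c, P, R, Fintype.linearCombination_apply_single]
  have := Matrix.trace_det_coeff_eq_zero_of_isNilpotent hK (LinearMap.toMatrix b b A)
    (LinearMap.toMatrix c b P) (LinearMap.toMatrix b c R) (fun t => by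
      rw [← LinearMap.toMatrix_comp, hPR, ← map_smul, ← map_add]
      exact (h t).map (LinearMap.toMatrixAlgEquiv b)) k
  simpa [hT] using this

section Operators

variable {K E F : Type*} [Field K] [AddCommGroup E] [Module K E] [AddCommGroup F] [Module K F]

/-- The linear map `M ↦ π ∘ M ∘ s`. -/
def LinearMap.compress {G : Type*} [AddCommGroup G] [Module K G]
    (π : E →ₗ[K] G) (s : F →ₗ[K] E) : End K E →ₗ[K] (F →ₗ[K] G) where
  toFun M := π ∘ₗ M ∘ₗ s
  map_add' M N := by ext; simp
  map_smul' a M := by ext; simp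

@[simp]
theorem LinearMap.compress_apply {G : Type*} [AddCommGroup G] [Module K G]
    (π : E →ₗ[K] G) (s : F →ₗ[K] E) (M : End K E) (v : F) :
    LinearMap.compress π s M v = π (M (s v)) := rfl

theorem LinearMap.isNilpotent_compress_of_ker {π : E →ₗ[K] F} {s : F →ₗ[K] E}
    (hs : ∀ v, π (s v) = v) {M : End K E} (hM : IsNilpotent M)
    (h : ∀ v, π v = 0 → π (M v) = 0) :
    IsNilpotent (LinearMap.compress π s M : End K F) := by
  obtain ⟨k, hk⟩ := hM
  have h1 : ∀ v, LinearMap.compress π s M (π v) = π (M v) := fun v => by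
    have := h (s (π v) - v) (by simp [hs])
    simpa [sub_eq_zero] using this
  have h2 : ∀ (m : ℕ) (v : E),
      ((LinearMap.compress π s M : End K F) ^ m) (π v) = π ((M ^ m) v) := by
    intro m
    induction m with
    | zero => intro v; rfl
    | succ m ih => intro v; rw [pow_succ, pow_succ, End.mul_apply, End.mul_apply, h1, ih]
  refine ⟨k, LinearMap.ext fun v => ?_⟩
  rw [← hs v, h2, hk]
  simp

theorem LinearMap.isNilpotent_compress_of_range {π : E →ₗ[K] F} {s : F →ₗ[K] E}
    (hs : ∀ v, π (s v) = v) {M : End K E} (hM : IsNilpotent M)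
    (h : ∀ v, s (π (M (s v))) = M (s v)) :
    IsNilpotent (LinearMap.compress π s M : End K F) := by
  obtain ⟨k, hk⟩ := hM
  have h2 : ∀ (m : ℕ) (v : F),
      s (((LinearMap.compress π s M : End K F) ^ m) v) = (M ^ m) (s v) := by
    intro m
    induction m with
    | zero => intro v; rfl
    | succ m ih => intro v; rw [pow_succ, pow_succ, End.mul_apply, End.mul_apply, ih,
        LinearMap.compress_apply, h]
  refine ⟨k, LinearMap.ext fun v => ?_⟩
  rw [← hs (((LinearMap.compress π s M : End K F) ^ k) v), h2, hk]
  simp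

namespace NilpotentSpace

/-- The space `V x` of all images of `x` under operators of `V`. -/
def orbit (V : Submodule K (End K E)) (x : E) : Submodule K E :=
  V.map (LinearMap.applyₗ x)

/-- The linear forms `φ` such that the operator `v ↦ φ v • x` belongs to `V`. -/
def forms (V : Submodule K (End K E)) (x : E) : Submodule K (Dual K E) :=
  V.comap (LinearMap.smulRightₗ.flip x)

/-- The operators induced on a quotient `π : E → F` (with section `s`) by those operators of `V`
that annihilate `x`. -/
def reduce (V : Submodule K (End K E)) (x : E) (π : E →ₗ[K] F) (s : F →ₗ[K] E) :
    Submodule K (End K F) :=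
  (V ⊓ (LinearMap.applyₗ x : End K E →ₗ[K] E).ker).map (LinearMap.compress π s)

theorem mem_orbit {V : Submodule K (End K E)} {x y : E} :
    y ∈ orbit V x ↔ ∃ A ∈ V, A x = y := Iff.rfl

theorem mem_forms {V : Submodule K (End K E)} {x : E} {φ : Dual K E} :
    φ ∈ forms V x ↔ φ.smulRight x ∈ V := Iff.rfl

theorem mem_reduce {V : Submodule K (End K E)} {x : E} {π : E →ₗ[K] F} {s : F →ₗ[K] E}
    {N : End K F} :
    N ∈ reduce V x π s ↔ ∃ M ∈ V, M x = 0 ∧ LinearMap.compress π s M = N := by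
  simp [reduce, and_assoc]

variable {V : Submodule K (End K E)}

theorem isNilpotent_of_mem_reduce (hV : ∀ M ∈ V, IsNilpotent M) {x : E} {π : E →ₗ[K] F}
    {s : F →ₗ[K] E} (hs : ∀ v, π (s v) = v) (hπ : π.ker = Submodule.span K {x}) :
    ∀ M ∈ reduce V x π s, IsNilpotent M := by
  intro N hN
  obtain ⟨M, hM, hMx, rfl⟩ := mem_reduce.1 hN
  refine LinearMap.isNilpotent_compress_of_ker hs (hV M hM) fun v hv => ?_
  have : v ∈ Submodule.span K {x} := hπ ▸ LinearMap.mem_ker.2 hv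
  obtain ⟨a, rfl⟩ := Submodule.mem_span_singleton.1 this
  simp [hMx]

theorem eq_zero_of_apply_eq_smul {A : End K E} (hA : IsNilpotent A) {x : E} (hx : x ≠ 0)
    {a : K} (h : A x = a • x) : a = 0 := by
  obtain ⟨k, hk⟩ := hA
  have h1 : ∀ m : ℕ, (A ^ m) x = a ^ m • x := by
    intro m
    induction m with
    | zero => simp
    | succ m ih => rw [pow_succ, End.mul_apply, h, map_smul, ih, smul_smul, pow_succ, mul_comm]
  have h2 := h1 k
  rw [hk] at h2
  have h3 : a ^ k = 0 := by simpa [hx] using h2.symm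
  exact eq_zero_of_pow_eq_zero h3

/-- A quotient map modulo the line through `x`, with a section. -/
theorem exists_section (x : E) :
    ∃ s : (E ⧸ Submodule.span K {x}) →ₗ[K] E, ∀ v, (Submodule.span K {x}).mkQ (s v) = v := by
  obtain ⟨s, hs⟩ := LinearMap.exists_rightInverse_of_surjective
    (Submodule.span K {x}).mkQ (Submodule.range_mkQ _)
  exact ⟨s, fun v => LinearMap.congr_fun hs v⟩

variable [FiniteDimensional K E]

theorem finrank_add_one_eq {x : E} (hx : x ≠ 0) {π : E →ₗ[K] F}
    {s : F →ₗ[K] E} (hs : ∀ v, π (s v) = v) (hπ : π.ker = Submodule.span K {x}) :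
    finrank K F + 1 = finrank K E := by
  rw [← LinearMap.finrank_range_add_finrank_ker π, hπ, finrank_span_singleton hx,
    LinearMap.range_eq_top.2 fun v => ⟨_, hs v⟩, finrank_top]

theorem form_apply_pow_eq_zero (hK : 3 ≤ Cardinal.mk K) (hV : ∀ M ∈ V, IsNilpotent M)
    {x : E} {φ : Dual K E} (hφ : φ ∈ forms V x) {A : End K E} (hA : A ∈ V) (k : ℕ) :
    φ ((A ^ k) x) = 0 := by
  have := (Module.End.rank_two_of_isNilpotent hK A x 0 φ 0 (fun t => hV _ (V.add_mem hA
    (V.smul_mem t (by simpa using mem_forms.1 hφ)))) k).1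
  simpa using this

theorem rank_two_relations (hK : 3 ≤ Cardinal.mk K) (hV : ∀ M ∈ V, IsNilpotent M)
    {p x : E} {φ ψ : Dual K E} (hM : φ.smulRight p + ψ.smulRight x ∈ V)
    {A : End K E} (hA : A ∈ V) (k : ℕ) :
    φ ((A ^ k) p) + ψ ((A ^ k) x) = 0 ∧
    ∑ ij ∈ Finset.HasAntidiagonal.antidiagonal k, (φ ((A ^ ij.1) p) * ψ ((A ^ ij.2) x)
      - φ ((A ^ ij.1) x) * ψ ((A ^ ij.2) p)) = 0 :=
  Module.End.rank_two_of_isNilpotent hK A p x φ ψ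
    (fun t => hV _ (V.add_mem hA (V.smul_mem t hM))) k

theorem forms_le (hK : 3 ≤ Cardinal.mk K) (hV : ∀ M ∈ V, IsNilpotent M) (x : E) :
    forms V x ≤ (orbit V x ⊔ Submodule.span K {x}).dualAnnihilator := by
  intro φ hφ
  rw [Submodule.mem_dualAnnihilator]
  intro w hw
  obtain ⟨y, hy, z, hz, rfl⟩ := Submodule.mem_sup.1 hw
  obtain ⟨A, hA, rfl⟩ := mem_orbit.1 hy
  obtain ⟨a, rfl⟩ := Submodule.mem_span_singleton.1 hz
  have h0 := form_apply_pow_eq_zero hK hV hφ hA 0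
  have h1 := form_apply_pow_eq_zero hK hV hφ hA 1
  simp at h0 h1
  simp [h0, h1]

theorem finrank_orbit_sup (hV : ∀ M ∈ V, IsNilpotent M) {x : E} (hx : x ≠ 0) :
    finrank K ↥(orbit V x ⊔ Submodule.span K {x}) = finrank K (orbit V x) + 1 := by
  have hdis : orbit V x ⊓ Submodule.span K {x} = ⊥ := by
    rw [eq_bot_iff]
    rintro y ⟨hy, hy'⟩
    obtain ⟨A, hA, rfl⟩ := mem_orbit.1 hy
    obtain ⟨a, ha⟩ := Submodule.mem_span_singleton.1 hy'
    have := eq_zero_of_apply_eq_smul (hV A hA) hx ha.symm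
    simp [← ha, this]
  have := Submodule.finrank_sup_add_finrank_inf_eq (orbit V x) (Submodule.span K {x})
  rwa [hdis, finrank_bot, finrank_span_singleton hx, add_zero] at this

theorem finrank_forms_dualAnnihilator (hV : ∀ M ∈ V, IsNilpotent M) {x : E} (hx : x ≠ 0) :
    finrank K (orbit V x) + 1 +
      finrank K (orbit V x ⊔ Submodule.span K {x}).dualAnnihilator = finrank K E := by
  rw [← finrank_orbit_sup hV hx]
  exact Subspace.finrank_add_finrank_dualAnnihilator_eq _

theorem _root_.Submodule.finrank_map_add_finrank_inf_ker {E' : Type*} [AddCommGroup E']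
    [Module K E'] (W : Submodule K E) (f : E →ₗ[K] E') :
    finrank K (W.map f) + finrank K ↥(W ⊓ f.ker) = finrank K W := by
  rw [← LinearMap.finrank_range_add_finrank_ker (f.domRestrict W), LinearMap.range_domRestrict,
    LinearMap.ker_domRestrict, ← Submodule.finrank_map_subtype_eq, Submodule.map_comap_subtype]

theorem finrank_le_add_add {x : E} (hx : x ≠ 0) {π : E →ₗ[K] F}
    {s : F →ₗ[K] E} (hs : ∀ v, π (s v) = v) (hπ : π.ker = Submodule.span K {x}) :
    finrank K V ≤ finrank K (orbit V x) + finrank K (reduce V x π s) + finrank K (forms V x) := by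
  have : FiniteDimensional K F := Module.Finite.of_surjective π fun v => ⟨_, hs v⟩
  obtain ⟨ξ, hξ⟩ := Projective.exists_dual_eq_one K hx
  have h1 := V.finrank_map_add_finrank_inf_ker (LinearMap.applyₗ x : End K E →ₗ[K] E)
  set W := V ⊓ (LinearMap.applyₗ x : End K E →ₗ[K] E).ker with hW
  have h2 := W.finrank_map_add_finrank_inf_ker (LinearMap.compress π s : End K E →ₗ[K] End K F)
  have h3 : W ⊓ (LinearMap.compress π s : End K E →ₗ[K] End K F).ker ≤
      (forms V x).map (LinearMap.smulRightₗ.flip x) := by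
    rintro M ⟨⟨hM, hMx⟩, hM0⟩
    have hMx : M x = 0 := hMx
    have hM0 : ∀ v, π (M (s v)) = 0 := fun v => LinearMap.congr_fun hM0 v
    have hM' : (ξ ∘ₗ M).smulRight x = M := by
      ext v
      have hv : s (π v) - v ∈ π.ker := by simp [hs]
      rw [hπ] at hv
      obtain ⟨a, ha⟩ := Submodule.mem_span_singleton.1 hv
      have h4 : M v = M (s (π v)) := by
        rw [eq_comm, ← sub_eq_zero, ← map_sub, ← ha, map_smul, hMx, smul_zero]
      have h5 : M v ∈ π.ker := by rw [LinearMap.mem_ker, h4, hM0]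
      rw [hπ] at h5
      obtain ⟨a, ha⟩ := Submodule.mem_span_singleton.1 h5
      simp [← ha, hξ]
    exact ⟨ξ ∘ₗ M, mem_forms.2 (hM'.symm ▸ hM), hM'⟩
  have h4 : finrank K ↥(W ⊓ (LinearMap.compress π s : End K E →ₗ[K] End K F).ker) ≤
      finrank K (forms V x) := (Submodule.finrank_mono h3).trans (Submodule.finrank_map_le _ _)
  change finrank K (orbit V x) + _ = _ at h1
  change finrank K (reduce V x π s) + _ = _ at h2
  omega

end NilpotentSpace

end Operators

namespace NilpotentSpace

theorem finrank_le_choose_two {K : Type*} [Field K] (hK : 3 ≤ Cardinal.mk K) (n : ℕ) :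
    ∀ (E : Type*) [AddCommGroup E] [Module K E] [FiniteDimensional K E], finrank K E = n →
      ∀ V : Submodule K (End K E), (∀ M ∈ V, IsNilpotent M) → finrank K V ≤ n.choose 2 := by
  induction n with
  | zero =>
    intro E _ _ _ hE V hV
    have := V.finrank_le
    rw [finrank_linearMap, hE] at this
    exact this
  | succ n ih =>
    intro E _ _ _ hE V hV
    have : Nontrivial E := nontrivial_of_finrank_pos (R := K) (by omega)
    obtain ⟨x, hx⟩ := exists_ne (0 : E)
    obtain ⟨s, hs⟩ := exists_section (K := K) x
    have hπ := Submodule.ker_mkQ (Submodule.span K {x})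
    have h1 := finrank_le_add_add (V := V) hx hs hπ
    have h2 := finrank_add_one_eq hx hs hπ
    have h3 := ih (E ⧸ Submodule.span K {x}) (by omega) _ (isNilpotent_of_mem_reduce hV hs hπ)
    have h4 := finrank_forms_dualAnnihilator hV hx
    have h5 := Submodule.finrank_mono (forms_le hK hV x)
    rw [Nat.choose_succ_succ' n 1, Nat.choose_one_right, one_add_one_eq_two]
    omega

variable {K E F : Type*} [Field K] [AddCommGroup E] [Module K E] [AddCommGroup F] [Module K F]
  [FiniteDimensional K E] {V : Submodule K (End K E)}

section Maximal

theorem forms_eq_and_finrank_reduce [FiniteDimensional K F] (hK : 3 ≤ Cardinal.mk K) (hV : ∀ M ∈ V, IsNilpotent M)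
    (hmax : finrank K V = (finrank K E).choose 2) {x : E} (hx : x ≠ 0) {π : E →ₗ[K] F}
    {s : F →ₗ[K] E} (hs : ∀ v, π (s v) = v) (hπ : π.ker = Submodule.span K {x}) :
    forms V x = (orbit V x ⊔ Submodule.span K {x}).dualAnnihilator ∧
      finrank K (reduce V x π s) = (finrank K F).choose 2 := by
  have h1 := finrank_le_add_add (V := V) hx hs hπ
  have h2 := finrank_add_one_eq hx hs hπ
  have h3 := finrank_le_choose_two hK _ F rfl _ (isNilpotent_of_mem_reduce hV hs hπ)
  have h4 := finrank_forms_dualAnnihilator hV hx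
  have h5 := Submodule.finrank_mono (forms_le hK hV x)
  rw [← h2, Nat.choose_succ_succ' _ 1, Nat.choose_one_right, one_add_one_eq_two] at hmax
  exact ⟨Submodule.eq_of_le_of_finrank_le (forms_le hK hV x) (by omega), by omega⟩

theorem forms_eq (hK : 3 ≤ Cardinal.mk K) (hV : ∀ M ∈ V, IsNilpotent M)
    (hmax : finrank K V = (finrank K E).choose 2) {x : E} (hx : x ≠ 0) :
    forms V x = (orbit V x ⊔ Submodule.span K {x}).dualAnnihilator := by
  obtain ⟨s, hs⟩ := exists_section (K := K) x
  exact (forms_eq_and_finrank_reduce hK hV hmax hx hs (Submodule.ker_mkQ _)).1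

theorem smulRight_mem (hK : 3 ≤ Cardinal.mk K) (hV : ∀ M ∈ V, IsNilpotent M)
    (hmax : finrank K V = (finrank K E).choose 2) {x : E} (hx : x ≠ 0) {φ : Dual K E}
    (hφ : φ x = 0) (hφV : ∀ A ∈ V, φ (A x) = 0) : φ.smulRight x ∈ V := by
  rw [← mem_forms, forms_eq hK hV hmax hx, Submodule.mem_dualAnnihilator]
  intro w hw
  obtain ⟨y, hy, z, hz, rfl⟩ := Submodule.mem_sup.1 hw
  obtain ⟨A, hA, rfl⟩ := mem_orbit.1 hy
  obtain ⟨a, rfl⟩ := Submodule.mem_span_singleton.1 hz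
  simp [hφ, hφV A hA]

/-- A rank-one operator of the reduced space lifts to an operator of `V` of rank at most two. -/
theorem exists_lift_of_smulRight_mem_reduce {x : E} (hx : x ≠ 0) {π : E →ₗ[K] F}
    {s : F →ₗ[K] E} (hs : ∀ v, π (s v) = v) (hπ : π.ker = Submodule.span K {x})
    {φ : Dual K F} {p : E} (h : φ.smulRight (π p) ∈ reduce V x π s) :
    ∃ ψ : Dual K E, ψ x = 0 ∧ (φ ∘ₗ π).smulRight p + ψ.smulRight x ∈ V := by
  obtain ⟨M, hM, hMx, hMφ⟩ := mem_reduce.1 h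
  have hπx : π x = 0 := by
    rw [← LinearMap.mem_ker, hπ]; exact Submodule.mem_span_singleton_self x
  obtain ⟨ξ, hξ⟩ := Projective.exists_dual_eq_one K hx
  refine ⟨ξ ∘ₗ (M - (φ ∘ₗ π).smulRight p), by simp [hMx, hπx], ?_⟩
  convert hM using 1
  ext v
  have hv : s (π v) - v ∈ π.ker := by simp [hs]
  rw [hπ] at hv
  obtain ⟨a, ha⟩ := Submodule.mem_span_singleton.1 hv
  have h4 : M v = M (s (π v)) := by
    rw [eq_comm, ← sub_eq_zero, ← map_sub, ← ha, map_smul, hMx, smul_zero]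
  have h5 : M v - φ (π v) • p ∈ π.ker := by
    have := LinearMap.congr_fun hMφ (π v)
    simp only [LinearMap.compress_apply, LinearMap.smulRight_apply] at this
    rw [LinearMap.mem_ker, map_sub, h4, this, map_smul, sub_self]
  rw [hπ] at h5
  obtain ⟨b, hb⟩ := Submodule.mem_span_singleton.1 h5
  simp only [LinearMap.add_apply, LinearMap.smulRight_apply, LinearMap.comp_apply,
    LinearMap.sub_apply, ← hb, map_smul, hξ, smul_eq_mul, mul_one]
  rw [hb]
  abel

theorem form_apply_apply_eq_zero (hK : 3 ≤ Cardinal.mk K) (hV : ∀ M ∈ V, IsNilpotent M)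
    (hmax : finrank K V = (finrank K E).choose 2) {x : E} (hx : x ≠ 0) {φ : Dual K E}
    (hφ : φ ∈ forms V x) {A B : End K E} (hA : A ∈ V) (hB : B ∈ V) : φ (A (B x)) = 0 := by
  by_cases hc : B x = 0
  · simp [hc]
  obtain ⟨s, hs⟩ := exists_section (K := K) x
  set π := (Submodule.span K {x}).mkQ with hπdef
  have hπ : π.ker = Submodule.span K {x} := Submodule.ker_mkQ _
  have hπx : π x = 0 := by
    rw [← LinearMap.mem_ker, hπ]; exact Submodule.mem_span_singleton_self x
  have hφk : ∀ {A : End K E}, A ∈ V → ∀ k : ℕ, φ ((A ^ k) x) = 0 := fun hA k =>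
    form_apply_pow_eq_zero hK hV hφ hA k
  have hφx : φ x = 0 := by simpa using hφk hA 0
  have hφ1 : ∀ {A : End K E}, A ∈ V → φ (A x) = 0 := fun hA => by simpa using hφk hA 1
  have hφ2 : ∀ {A : End K E}, A ∈ V → φ (A (A x)) = 0 := fun hA => by
    simpa [pow_succ] using hφk hA 2
  have hred := (forms_eq_and_finrank_reduce hK hV hmax hx hs hπ).2
  have hφs : ∀ v, φ (s (π v)) = φ v := by
    intro v
    have hv : s (π v) - v ∈ π.ker := by simp [hs]
    rw [hπ] at hv
    obtain ⟨a, ha⟩ := Submodule.mem_span_singleton.1 hv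
    rw [← sub_eq_zero, ← map_sub, ← ha, map_smul, hφx, smul_zero]
  have hπc : π (B x) ≠ 0 := by
    rw [Ne, ← LinearMap.mem_ker, hπ, Submodule.mem_span_singleton]
    rintro ⟨a, ha⟩
    have := eq_zero_of_apply_eq_smul (hV B hB) hx ha.symm
    exact hc (by rw [← ha, this, zero_smul])
  have hmem : (φ ∘ₗ s).smulRight (π (B x)) ∈ reduce V x π s := by
    refine smulRight_mem hK (isNilpotent_of_mem_reduce hV hs hπ) hred hπc ?_ ?_
    · simp [hφs, hφ1 hB]
    · intro N hN
      obtain ⟨M, hM, hMx, rfl⟩ := mem_reduce.1 hN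
      have hMs : M (s (π (B x))) = M (B x) := by
        have hv : s (π (B x)) - B x ∈ π.ker := by simp [hs]
        rw [hπ] at hv
        obtain ⟨a, ha⟩ := Submodule.mem_span_singleton.1 hv
        rw [← sub_eq_zero, ← map_sub, ← ha, map_smul, hMx, smul_zero]
      have := hφ2 (V.add_mem hM hB)
      simp [hMx, hφ2 hB] at this
      simp [hφs, hMs, this]
  obtain ⟨ψ, hψx, hψ⟩ := exists_lift_of_smulRight_mem_reduce hx hs hπ hmem
  have htr := (rank_two_relations hK hV hψ hA 1).1
  have hdet := (rank_two_relations hK hV hψ hA 2).2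
  simp [Finset.Nat.antidiagonal_succ, pow_succ, hφs, hφx, hφ1 hA, hφ1 hB, hφ2 hA, hψx] at htr hdet
  rcases hdet with h | h
  · exact h
  · simpa [h] using htr

end Maximal
end NilpotentSpace

namespace NilpotentSpace

variable {K E F : Type*} [Field K] [AddCommGroup E] [Module K E] [AddCommGroup F] [Module K F]
  [FiniteDimensional K E] {V : Submodule K (End K E)}

theorem exists_forms_ne_bot (hK : 3 ≤ Cardinal.mk K) (hV : ∀ M ∈ V, IsNilpotent M)
    (hmax : finrank K V = (finrank K E).choose 2) {x : E} (hx : x ≠ 0) {π : E →ₗ[K] F}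
    {s : F →ₗ[K] E} (hs : ∀ v, π (s v) = v) (hπ : π.ker = Submodule.span K {x})
    (hF : 2 ≤ finrank K F) {y : F} (hy : y ≠ 0) (hyV : ∀ N ∈ reduce V x π s, N y = 0) :
    ∃ z : E, z ≠ 0 ∧ forms V z ≠ ⊥ := by
  by_cases hbot : forms V x = ⊥
  swap
  · exact ⟨x, hx, hbot⟩
  have : FiniteDimensional K F := Module.Finite.of_surjective π fun v => ⟨_, hs v⟩
  have hred := (forms_eq_and_finrank_reduce hK hV hmax hx hs hπ).2
  have hπx : π x = 0 := by
    rw [← LinearMap.mem_ker, hπ]; exact Submodule.mem_span_singleton_self x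
  have hzero : ∀ χ : Dual K E, χ x = 0 → (∀ A ∈ V, χ (A x) = 0) → χ = 0 := by
    intro χ h1 h2
    have : χ ∈ forms V x := smulRight_mem hK hV hmax hx h1 h2
    rwa [hbot, Submodule.mem_bot] at this
  obtain ⟨φ', hφ', hφy⟩ := Submodule.exists_le_ker_of_lt_top (Submodule.span K {y}) (by
    rw [lt_top_iff_ne_top]
    intro h
    have := finrank_span_singleton (K := K) hy
    rw [h, finrank_top] at this
    omega)
  have hφy : φ' y = 0 := hφy (Submodule.mem_span_singleton_self y)
  have hmem : φ'.smulRight (π (s y)) ∈ reduce V x π s := by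
    rw [hs]
    exact smulRight_mem hK (isNilpotent_of_mem_reduce hV hs hπ) hred hy hφy
      fun A hA => by simp [hyV A hA]
  obtain ⟨ψ, hψx, hψ⟩ := exists_lift_of_smulRight_mem_reduce hx hs hπ hmem
  set φ : Dual K E := φ' ∘ₗ π with hφdef
  have hφx : φ x = 0 := by simp [hφdef, hπx]
  have hφp : φ (s y) = 0 := by simp [hφdef, hs, hφy]
  have hφ : φ ≠ 0 := by
    intro h
    apply hφ'
    ext v
    simpa [hφdef, hs] using LinearMap.congr_fun h (s v)
  by_cases hdep : ∃ a : K, ψ = a • φ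
  · obtain ⟨a, rfl⟩ := hdep
    refine ⟨s y + a • x, ?_, ?_⟩
    · intro h
      apply hy
      simpa [hs, hπx] using congrArg π h
    · rw [Submodule.ne_bot_iff]
      refine ⟨φ, ?_, hφ⟩
      rw [mem_forms]
      convert hψ using 1
      ext v
      simp [smul_smul, mul_comm]
  exfalso
  obtain ⟨A, hA, hφA, hψA⟩ : ∃ A ∈ V, φ (A x) = 0 ∧ ψ (A x) ≠ 0 := by
    by_contra! hcon
    let ev : V →ₗ[K] E := (LinearMap.applyₗ x : End K E →ₗ[K] E) ∘ₗ V.subtype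
    have hspan : ψ ∘ₗ ev ∈ Submodule.span K (Set.range fun _ : Unit => φ ∘ₗ ev) := by
      apply mem_span_of_iInf_ker_le_ker
      rintro ⟨A, hA⟩ hAk
      simp only [Submodule.mem_iInf, LinearMap.mem_ker] at hAk
      exact hcon A hA (hAk ())
    rw [Set.range_const, Submodule.mem_span_singleton] at hspan
    obtain ⟨a, ha⟩ := hspan
    refine hdep ⟨a, ?_⟩
    rw [← sub_eq_zero]
    refine hzero _ (by simp [hψx, hφx]) fun A hA => ?_
    have := LinearMap.congr_fun ha ⟨A, hA⟩
    simp only [LinearMap.sub_apply, LinearMap.smul_apply, sub_eq_zero]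
    exact this.symm
  obtain ⟨B, hB, hφB⟩ : ∃ B ∈ V, φ (B x) ≠ 0 := by
    by_contra! hcon
    exact hφ (hzero φ hφx hcon)
  have hψp : ψ (s y) = 0 := by
    have := (rank_two_relations hK hV hψ hB 1).2
    simpa [Finset.Nat.antidiagonal_succ, hφx, hφp, hψx, hφB] using this
  have htr := (rank_two_relations hK hV hψ hA 1).1
  have hdet := (rank_two_relations hK hV hψ hA 2).2
  simp [Finset.Nat.antidiagonal_succ, pow_succ, hφx, hφp, hψp, hψx, hψA, hφA] at htr hdet
  exact hψA (by simpa [hdet] using htr)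

theorem _root_.Nat.choose_two_add (a b : ℕ) :
    (a + b).choose 2 = a.choose 2 + b.choose 2 + a * b := by
  induction b with
  | zero => simp
  | succ b ih =>
    rw [← add_assoc, Nat.choose_succ_succ' (a + b) 1, Nat.choose_succ_succ' b 1,
      Nat.choose_one_right, Nat.choose_one_right, one_add_one_eq_two, ih]
    ring

theorem finrank_map_restrict (hK : 3 ≤ Cardinal.mk K) (hV : ∀ M ∈ V, IsNilpotent M)
    (hmax : finrank K V = (finrank K E).choose 2) {G : Submodule K E}
    (hG : ∀ M ∈ V, ∀ v ∈ G, M v ∈ G) {ρ : E →ₗ[K] G} (hρ : ∀ v : G, ρ v = v) :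
    (∀ N ∈ V.map (LinearMap.compress ρ G.subtype : End K E →ₗ[K] End K G), IsNilpotent N) ∧
    finrank K (V.map (LinearMap.compress ρ G.subtype : End K E →ₗ[K] End K G)) =
      (finrank K G).choose 2 := by
  have hρ' : ∀ v ∈ G, (ρ v : E) = v := fun v hv => congrArg Subtype.val (hρ ⟨v, hv⟩)
  have hnil : ∀ N ∈ V.map (LinearMap.compress ρ G.subtype : End K E →ₗ[K] End K G),
      IsNilpotent N := by
    rintro N ⟨M, hM, rfl⟩
    exact LinearMap.isNilpotent_compress_of_range hρ (hV M hM) fun v =>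
      hρ' _ (hG M hM _ v.2)
  refine ⟨hnil, ?_⟩
  obtain ⟨s, hs⟩ := LinearMap.exists_rightInverse_of_surjective G.mkQ (Submodule.range_mkQ _)
  replace hs : ∀ v, G.mkQ (s v) = v := fun v => LinearMap.congr_fun hs v
  have h1 := V.finrank_map_add_finrank_inf_ker
    (LinearMap.compress ρ G.subtype : End K E →ₗ[K] End K G)
  set W := V ⊓ (LinearMap.compress ρ G.subtype : End K E →ₗ[K] End K G).ker with hW
  have h2 := W.finrank_map_add_finrank_inf_ker
    (LinearMap.compress G.mkQ s : End K E →ₗ[K] End K (E ⧸ G))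
  set W' := W ⊓ (LinearMap.compress G.mkQ s : End K E →ₗ[K] End K (E ⧸ G)).ker with hW'
  have h3 := W'.finrank_map_add_finrank_inf_ker (LinearMap.compress ρ s)
  have h4 : W' ⊓ (LinearMap.compress ρ s).ker = ⊥ := by
    rw [eq_bot_iff]
    rintro M ⟨⟨⟨hM, hM1⟩, hM2⟩, hM3⟩
    have hMG : ∀ v ∈ G, M v = 0 := by
      intro v hv
      rw [← hρ' _ (hG M hM v hv)]
      exact congrArg Subtype.val (LinearMap.congr_fun hM1 ⟨v, hv⟩)
    have hMs : ∀ v, M (s v) = 0 := by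
      intro v
      have hmem : M (s v) ∈ G := by
        rw [← Submodule.Quotient.mk_eq_zero]
        exact LinearMap.congr_fun hM2 v
      rw [← hρ' _ hmem]
      exact congrArg Subtype.val (LinearMap.congr_fun hM3 v)
    rw [Submodule.mem_bot]
    ext v
    have hv : v - s (G.mkQ v) ∈ G := by
      rw [← Submodule.Quotient.mk_eq_zero]
      change G.mkQ (v - s (G.mkQ v)) = 0
      rw [map_sub, hs, sub_self]
    have := hMG _ hv
    rwa [map_sub, hMs, sub_zero] at this
  rw [h4, finrank_bot] at h3
  have h5 := (W'.map (LinearMap.compress ρ s)).finrank_le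
  rw [finrank_linearMap] at h5
  have h6 : finrank K (W.map (LinearMap.compress G.mkQ s : End K E →ₗ[K] End K (E ⧸ G))) ≤ _ :=
    finrank_le_choose_two hK _ (E ⧸ G) rfl _ (by
      rintro N ⟨M, hM, rfl⟩
      refine LinearMap.isNilpotent_compress_of_ker hs (hV M hM.1) fun v hv => ?_
      rw [← LinearMap.mem_ker, Submodule.ker_mkQ] at hv ⊢
      exact hG M hM.1 v hv)
  have h7 : finrank K (V.map (LinearMap.compress ρ G.subtype : End K E →ₗ[K] End K G)) ≤ _ :=
    finrank_le_choose_two hK _ G rfl _ hnil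
  rw [← G.finrank_quotient_add_finrank, Nat.choose_two_add] at hmax
  omega

theorem exists_common_kernel (hK : 3 ≤ Cardinal.mk K) (n : ℕ) :
    ∀ (E : Type*) [AddCommGroup E] [Module K E] [FiniteDimensional K E], finrank K E = n →
      0 < n → ∀ V : Submodule K (End K E), (∀ M ∈ V, IsNilpotent M) →
      finrank K V = n.choose 2 → ∃ y : E, y ≠ 0 ∧ ∀ M ∈ V, M y = 0 := by
  induction n using Nat.strong_induction_on with
  | _ n ih =>
  intro E _ _ _ hE hn V hV hmax
  have : Nontrivial E := nontrivial_of_finrank_pos (R := K) (by omega)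
  by_cases hn2 : n ≤ 2
  · have h1 : finrank K V ≤ 1 := by
      rw [hmax]
      exact Nat.choose_le_choose 2 hn2
    obtain ⟨A, hA⟩ := finrank_le_one_iff.1 h1
    have hker : (A : End K E).ker ≠ ⊥ := fun h =>
      (hV A A.2).not_isUnit ((LinearMap.isUnit_iff_ker_eq_bot _).2 h)
    obtain ⟨y, hy, hy0⟩ := (Submodule.ne_bot_iff _).1 hker
    refine ⟨y, hy0, fun M hM => ?_⟩
    obtain ⟨c, hc⟩ := hA ⟨M, hM⟩
    have hc' : c • (A : End K E) = M := congrArg Subtype.val hc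
    rw [← hc', LinearMap.smul_apply, LinearMap.mem_ker.1 hy, smul_zero]
  rw [← hE] at hmax
  obtain ⟨x, hx⟩ := exists_ne (0 : E)
  obtain ⟨z, hz, hforms⟩ : ∃ z : E, z ≠ 0 ∧ forms V z ≠ ⊥ := by
    obtain ⟨s, hs⟩ := exists_section (K := K) x
    have hπ := Submodule.ker_mkQ (Submodule.span K {x})
    have hF := finrank_add_one_eq hx hs hπ
    obtain ⟨y, hy, hyV⟩ := ih _ (by omega) (E ⧸ Submodule.span K {x}) rfl (by omega) _
      (isNilpotent_of_mem_reduce hV hs hπ) (forms_eq_and_finrank_reduce hK hV hmax hx hs hπ).2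
    exact exists_forms_ne_bot hK hV hmax hx hs hπ (by omega) hy hyV
  set G := orbit V z ⊔ Submodule.span K {z} with hGdef
  have hG : ∀ M ∈ V, ∀ v ∈ G, M v ∈ G := by
    intro A hA v hv
    obtain ⟨_, ⟨B, hB, rfl⟩, w, hw, rfl⟩ := Submodule.mem_sup.1 hv
    obtain ⟨a, rfl⟩ := Submodule.mem_span_singleton.1 hw
    rw [map_add, map_smul]
    refine G.add_mem ?_ (G.smul_mem a (Submodule.mem_sup_left (mem_orbit.2 ⟨A, hA, rfl⟩)))
    rw [← Subspace.forall_mem_dualAnnihilator_apply_eq_zero_iff]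
    intro φ hφ
    rw [hGdef, ← forms_eq hK hV hmax hz] at hφ
    exact form_apply_apply_eq_zero hK hV hmax hz hφ hA hB
  obtain ⟨ρ, hρ⟩ := LinearMap.exists_leftInverse_of_injective G.subtype (Submodule.ker_subtype G)
  replace hρ : ∀ v : G, ρ v = v := fun v => LinearMap.congr_fun hρ v
  have hGpos : 0 < finrank K G := by
    rw [hGdef, finrank_orbit_sup hV hz]
    omega
  have hGlt : finrank K G < n := by
    rw [← hE]
    refine Submodule.finrank_lt ?_
    rintro hGtop
    apply hforms
    rw [forms_eq hK hV hmax hz, ← hGdef, hGtop, Submodule.dualAnnihilator_top]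
  obtain ⟨hnil, hmaxG⟩ := finrank_map_restrict hK hV hmax hG hρ
  obtain ⟨y, hy, hyV⟩ := ih _ hGlt G rfl hGpos _ hnil hmaxG
  refine ⟨y, by simpa using hy, fun M hM => ?_⟩
  have h1 : ρ (M y) = 0 := hyV _ ⟨M, hM, rfl⟩
  have h2 := hρ ⟨M y, hG M hM _ y.2⟩
  rw [h1] at h2
  exact (congrArg Subtype.val h2).symm

theorem exists_basis_strictUpperTriangular (hK : 3 ≤ Cardinal.mk K) (n : ℕ) :
    ∀ (E : Type*) [AddCommGroup E] [Module K E] [FiniteDimensional K E], finrank K E = n →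
      ∀ V : Submodule K (End K E), (∀ M ∈ V, IsNilpotent M) → finrank K V = n.choose 2 →
      ∃ b : Basis (Fin n) K E, ∀ M ∈ V, ∀ i j, j ≤ i → b.repr (M (b j)) i = 0 := by
  induction n with
  | zero =>
    intro E _ _ _ hE V hV hmax
    exact ⟨finBasisOfFinrankEq K E hE, fun M hM i => i.elim0⟩
  | succ n ih =>
    intro E _ _ _ hE V hV hmax
    obtain ⟨y, hy, hyV⟩ := exists_common_kernel hK _ E hE n.succ_pos V hV hmax
    rw [← hE] at hmax
    obtain ⟨s, hs⟩ := exists_section (K := K) y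
    set π := (Submodule.span K {y}).mkQ with hπdef
    have hπ : π.ker = Submodule.span K {y} := Submodule.ker_mkQ (Submodule.span K {y})
    have hπy : π y = 0 := by
      rw [← LinearMap.mem_ker, hπ]; exact Submodule.mem_span_singleton_self y
    have hF := finrank_add_one_eq hy hs hπ
    have hred := (forms_eq_and_finrank_reduce hK hV hmax hy hs hπ).2
    have hFn : finrank K (E ⧸ Submodule.span K {y}) = n := by omega
    rw [hFn] at hred
    obtain ⟨b', hb'⟩ := ih (E ⧸ Submodule.span K {y}) hFn _
      (isNilpotent_of_mem_reduce hV hs hπ) hred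
    have hli : LinearIndependent K (Fin.cons y (s ∘ b') : Fin (n + 1) → E) := by
      rw [linearIndependent_finCons]
      constructor
      · refine b'.linearIndependent.map' s (LinearMap.ker_eq_bot.2 ?_)
        exact Function.LeftInverse.injective hs
      · intro hmem
        have h1 : Submodule.span K (Set.range (s ∘ b')) ≤ s.range := by
          rw [Submodule.span_le]
          rintro _ ⟨i, rfl⟩
          exact ⟨b' i, rfl⟩
        obtain ⟨q, hq⟩ := h1 hmem
        have hq0 : q = 0 := by rw [← hs q, hq, hπy]
        exact hy (by rw [← hq, hq0, map_zero])
    let b : Basis (Fin (n + 1)) K E := basisOfLinearIndependentOfCardEqFinrank hli (by simp [hE])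
    have hb : ∀ i, b i = (Fin.cons y (s ∘ b') : Fin (n + 1) → E) i := fun i => by simp [b]
    have hcoord : ∀ i : Fin n, b.coord i.succ = b'.coord i ∘ₗ π := by
      intro i
      refine b.ext fun j => ?_
      refine Fin.cases ?_ (fun j => ?_) j
      · have : b.coord i.succ (b 0) = 0 := by
          simp
        rw [this, hb]
        simp [hπy]
      · have : b.coord i.succ (b j.succ) = b'.coord i (b' j) := by
          simp [Finsupp.single_apply]
        rw [this, hb]
        simp [hs]
    refine ⟨b, fun M hM i j hij => ?_⟩
    revert hij
    refine Fin.cases (fun _ => ?_) (fun j hij => ?_) j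
    · rw [hb]
      simp [hyV M hM]
    · obtain ⟨i, rfl⟩ := Fin.exists_succ_eq.2 (Fin.ne_zero_of_lt (lt_of_lt_of_le j.succ_pos hij))
      have h1 := hb' _ (mem_reduce.2 ⟨M, hM, hyV M hM, rfl⟩) i j (Fin.succ_le_succ_iff.1 hij)
      have h2 := LinearMap.congr_fun (hcoord i) (M (b j.succ))
      rw [hb, Fin.cons_succ] at h2
      rw [hb, Fin.cons_succ]
      exact h2.trans h1

end NilpotentSpace

/-- The space of strictly upper triangular matrices as a linear subspace. -/
def strictUpperTriangularSubmodule (K : Type*) [Field K] (n : ℕ) :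
    Submodule K (Matrix (Fin n) (Fin n) K) where
  carrier := strictUpperTriangularSet K n
  add_mem' hM hN i j hij := by simp [hM i j hij, hN i j hij]
  zero_mem' _ _ _ := rfl
  smul_mem' a M hM i j hij := by simp [hM i j hij]

theorem isNilpotent_of_mem_strictUpperTriangularSet {K : Type*} [Field K] {n : ℕ}
    {M : Matrix (Fin n) (Fin n) K} (hM : M ∈ strictUpperTriangularSet K n) : IsNilpotent M := by
  have h1 : M.charpoly = X ^ n := by
    rw [Matrix.charpoly_of_isUpperTriangular M fun i j hij => hM i j (le_of_lt hij)]
    simp [hM _ _ le_rfl]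
  have h2 := M.aeval_self_charpoly
  rw [h1, map_pow, aeval_X] at h2
  exact ⟨n, h2⟩

end Auxiliary

/-- Gerstenhaber's theorem for `|K| ≥ 3`: a linear subspace of `M_n(K)` of dimension
`n(n-1)/2` consisting of nilpotent matrices is similar to the space of strictly upper
triangular matrices. -/
theorem gerstenhaber (K : Type*) [Field K] (hK : 3 ≤ Cardinal.mk K) (n : ℕ)
    (V : Submodule K (Matrix (Fin n) (Fin n) K))
    (hdim : Module.finrank K V = n * (n - 1) / 2)
    (hnil : ∀ M ∈ V, IsNilpotent M) :
    SimilarSets (strictUpperTriangularSet K n) (V : Set (Matrix (Fin n) (Fin n) K)) := by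
  have hnil' : ∀ U : Submodule K (Matrix (Fin n) (Fin n) K), (∀ M ∈ U, IsNilpotent M) →
      ∀ A ∈ U.map (Matrix.toLin' : Matrix (Fin n) (Fin n) K ≃ₗ[K] _).toLinearMap,
        IsNilpotent (A : Module.End K (Fin n → K)) := by
    rintro U hU _ ⟨M, hM, rfl⟩
    exact (hU M hM).map Matrix.toLinAlgEquiv'
  have hfin : ∀ U : Submodule K (Matrix (Fin n) (Fin n) K), Module.finrank K
      (U.map (Matrix.toLin' : Matrix (Fin n) (Fin n) K ≃ₗ[K] _).toLinearMap) =
        Module.finrank K U := fun U => LinearEquiv.finrank_map_eq _ U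
  obtain ⟨b, hb⟩ := NilpotentSpace.exists_basis_strictUpperTriangular hK n (Fin n → K) (by simp)
    _ (hnil' V hnil) (by rw [Nat.choose_two_right, ← hdim]; exact hfin V)
  set e := Pi.basisFun K (Fin n) with he
  set P := e.toMatrix b with hP
  have hPinv : P * b.toMatrix e = 1 := Module.Basis.toMatrix_mul_toMatrix_flip e b
  have hPi : P⁻¹ = b.toMatrix e := Matrix.inv_eq_right_inv hPinv
  refine ⟨P, IsUnit.of_mul_eq_one _ hPinv, ?_⟩
  let f : Matrix (Fin n) (Fin n) K →ₗ[K] Matrix (Fin n) (Fin n) K :=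
    LinearMap.mulLeft K P ∘ₗ LinearMap.mulRight K P⁻¹
  have hf : ∀ M, f M = P * M * P⁻¹ := fun M => by simp [f, Matrix.mul_assoc]
  have hle : V ≤ (strictUpperTriangularSubmodule K n).map f := by
    intro M hM
    refine ⟨LinearMap.toMatrix b b (Matrix.toLin' M), fun i j hij => ?_, ?_⟩
    · rw [LinearMap.toMatrix_apply]
      exact hb _ ⟨M, hM, rfl⟩ i j hij
    · rw [hf, hPi, hP, basis_toMatrix_mul_linearMap_toMatrix_mul_basis_toMatrix, he,
        LinearMap.toMatrix_eq_toMatrix', LinearMap.toMatrix'_toLin']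
  have hNT := NilpotentSpace.finrank_le_choose_two hK n (Fin n → K) (by simp) _
    (hnil' (strictUpperTriangularSubmodule K n)
      fun M hM => isNilpotent_of_mem_strictUpperTriangularSet hM)
  rw [Nat.choose_two_right, ← hdim] at hNT
  have heq := Submodule.eq_of_le_of_finrank_le hle
    ((Submodule.finrank_map_le f _).trans ((hfin _).symm.le.trans hNT))
  rw [heq, Submodule.map_coe]
  exact Set.image_congr fun M _ => hf M
end

section
/- Over the field F_2 with two elements, let A = [[0,1,0],[0,0,0],[0,1,0]], B = [[1,0,1],[1,0,0],[1,0,0]] and C = [[0,0,0],[0,1,1],[1,1,0]] in M_3(F_2), and let V be the linear span of {A, B, C}. Then V is a 3-dimensional linear subspace of M_3(F_2) with a trivial spectrum (indeed det(I_3 + xA + yB + zC) = 1 for all x, y, z ∈ F_2), and V is irreducible: the only linear subspaces of F_2^3 invariant under every matrix of V are {0} and F_2^3. In particular, M_3(F_2) contains an irreducible maximal linear subspace with a trivial spectrum, even though no matrix of GL_3(F_2) is non-isotropic. -/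
open Matrix

/-- The matrix `A` of the counterexample over `F_2`. -/
def matA : Matrix (Fin 3) (Fin 3) (ZMod 2) := !![0, 1, 0; 0, 0, 0; 0, 1, 0]

/-- The matrix `B` of the counterexample over `F_2`. -/
def matB : Matrix (Fin 3) (Fin 3) (ZMod 2) := !![1, 0, 1; 1, 0, 0; 1, 0, 0]

/-- The matrix `C` of the counterexample over `F_2`. -/
def matC : Matrix (Fin 3) (Fin 3) (ZMod 2) := !![0, 0, 0; 0, 1, 1; 1, 1, 0]

/-- A ternary quadratic form over `F_2` has a nontrivial zero. -/
lemma exists_isotropic_ternary_form : ∀ a b c d e f : ZMod 2,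
    ∃ x y z : ZMod 2, ¬(x = 0 ∧ y = 0 ∧ z = 0) ∧
      a * x * x + b * y * y + c * z * z + d * x * y + e * x * z + f * y * z = 0 := by
  decide

lemma exists_isotropic_vector (P : Matrix (Fin 3) (Fin 3) (ZMod 2)) :
    ∃ X : Fin 3 → ZMod 2, X ≠ 0 ∧ X ⬝ᵥ P.mulVec X = 0 := by
  obtain ⟨x, y, z, hne, h⟩ := exists_isotropic_ternary_form (P 0 0) (P 1 1) (P 2 2)
    (P 0 1 + P 1 0) (P 0 2 + P 2 0) (P 1 2 + P 2 1)
  refine ⟨![x, y, z], fun h0 => hne ?_, ?_⟩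
  · exact ⟨congrFun h0 0, congrFun h0 1, congrFun h0 2⟩
  · rw [← h]
    simp only [dotProduct, mulVec, Fin.sum_univ_three, cons_val]
    ring

lemma det_one_add_combination (x y z : ZMod 2) :
    (1 + x • matA + y • matB + z • matC).det = 1 := by
  revert x y z
  simp only [det_fin_three, matA, matB, matC, Matrix.add_apply, Matrix.smul_apply, one_apply, of_apply,
    cons_val, smul_eq_mul]
  decide

lemma linearIndependent_matABC : LinearIndependent (ZMod 2) ![matA, matB, matC] := by
  rw [Fintype.linearIndependent_iff]
  intro g hg
  have hB := congrFun (congrFun hg 0) 0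
  have hA := congrFun (congrFun hg 0) 1
  have hC := congrFun (congrFun hg 1) 1
  simp [Fin.sum_univ_three, matA, matB, matC] at hA hB hC
  intro i
  fin_cases i
  exacts [hA, hB, hC]

lemma finrank_span_matABC :
    Module.finrank (ZMod 2) (Submodule.span (ZMod 2)
      ({matA, matB, matC} : Set (Matrix (Fin 3) (Fin 3) (ZMod 2)))) = 3 := by
  have h := finrank_span_eq_card linearIndependent_matABC
  have hr : Set.range ![matA, matB, matC] = {matA, matB, matC} := by
    simp only [range_cons, range_empty, Set.union_empty, Set.singleton_union]
  rwa [hr, Fintype.card_fin] at h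

lemma trivialSpectrum_span_matABC :
    TrivialSpectrum ((Submodule.span (ZMod 2) {matA, matB, matC} :
      Submodule (ZMod 2) (Matrix (Fin 3) (Fin 3) (ZMod 2))) :
      Set (Matrix (Fin 3) (Fin 3) (ZMod 2))) := by
  intro M hM X hX
  obtain ⟨x, y, z, rfl⟩ := Submodule.mem_span_triple.mp hM
  refine eq_zero_of_mulVec_eq_zero (M := 1 + x • matA + y • matB + z • matC) ?_ ?_
  · rw [det_one_add_combination]
    exact one_ne_zero
  · rw [add_assoc, add_assoc, ← add_assoc (x • matA), add_mulVec, one_mulVec, hX]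
    exact CharTwo.add_self_eq_zero X

lemma eq_top_of_mem_of_apply_one_ne_zero (W : Submodule (ZMod 2) (Fin 3 → ZMod 2))
    (hA : ∀ x ∈ W, matA.mulVec x ∈ W) (hB : ∀ x ∈ W, matB.mulVec x ∈ W)
    {w : Fin 3 → ZMod 2} (hw : w ∈ W) (h1 : w 1 ≠ 0) : W = ⊤ := by
  have hw1 : w 1 = 1 := Fin.eq_one_of_ne_zero _ h1
  have hu : ![1, 0, 1] ∈ W := by
    have hAw : matA.mulVec w = ![1, 0, 1] := by
      ext i
      fin_cases i <;> simp [matA, mulVec, dotProduct, Fin.sum_univ_three, hw1]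
    exact hAw ▸ hA w hw
  have hv : ![0, 1, 1] ∈ W := by
    have hBu : matB.mulVec ![1, 0, 1] = ![0, 1, 1] := by decide
    exact hBu ▸ hB _ hu
  have he : ![1, 0, 0] ∈ W := by
    have hBv : matB.mulVec ![0, 1, 1] = ![1, 0, 0] := by decide
    exact hBv ▸ hB _ hv
  refine eq_top_iff.mpr fun x _ => ?_
  have hx : ∀ x : Fin 3 → ZMod 2, x = (x 0 + x 1 + x 2) • ![1, 0, 0] + x 1 • ![0, 1, 1]
      + (x 1 + x 2) • ![1, 0, 1] := by
    decide
  rw [hx x]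
  exact W.add_mem (W.add_mem (W.smul_mem _ he) (W.smul_mem _ hv)) (W.smul_mem _ hu)

lemma exists_apply_one_ne_zero : ∀ x : Fin 3 → ZMod 2, x ≠ 0 →
    x 1 ≠ 0 ∨ matC.mulVec x 1 ≠ 0 ∨ matB.mulVec x 1 ≠ 0 := by
  decide

lemma eq_bot_or_eq_top_of_invariant (W : Submodule (ZMod 2) (Fin 3 → ZMod 2))
    (hA : ∀ x ∈ W, matA.mulVec x ∈ W) (hB : ∀ x ∈ W, matB.mulVec x ∈ W)
    (hC : ∀ x ∈ W, matC.mulVec x ∈ W) : W = ⊥ ∨ W = ⊤ := by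
  refine or_iff_not_imp_left.mpr fun hW => ?_
  obtain ⟨x, hx, hx0⟩ := W.ne_bot_iff.mp hW
  rcases exists_apply_one_ne_zero x hx0 with h | h | h
  · exact eq_top_of_mem_of_apply_one_ne_zero W hA hB hx h
  · exact eq_top_of_mem_of_apply_one_ne_zero W hA hB (hC x hx) h
  · exact eq_top_of_mem_of_apply_one_ne_zero W hA hB (hB x hx) h

/-- Over `F_2`, the span `V` of `A, B, C` is a `3`-dimensional linear subspace of
`M_3(F_2)` with a trivial spectrum (indeed `det (I_3 + xA + yB + zC) = 1` for all
`x, y, z ∈ F_2`) which is irreducible; in particular `M_3(F_2)` contains an irreducible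
maximal linear subspace with a trivial spectrum, even though no matrix of `GL_3(F_2)` is
non-isotropic. -/
theorem counterexample_F2 :
    (∀ x y z : ZMod 2, (1 + x • matA + y • matB + z • matC).det = 1) ∧
    Module.finrank (ZMod 2)
      (Submodule.span (ZMod 2) {matA, matB, matC} :
        Submodule (ZMod 2) (Matrix (Fin 3) (Fin 3) (ZMod 2))) = 3 ∧
    TrivialSpectrum
      ((Submodule.span (ZMod 2) {matA, matB, matC} :
        Submodule (ZMod 2) (Matrix (Fin 3) (Fin 3) (ZMod 2))) :
        Set (Matrix (Fin 3) (Fin 3) (ZMod 2))) ∧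
    (∀ W : Submodule (ZMod 2) (Fin 3 → ZMod 2),
      (∀ M ∈ Submodule.span (ZMod 2)
          ({matA, matB, matC} : Set (Matrix (Fin 3) (Fin 3) (ZMod 2))),
        ∀ x ∈ W, M.mulVec x ∈ W) → W = ⊥ ∨ W = ⊤) ∧
    (∀ P : Matrix (Fin 3) (Fin 3) (ZMod 2), IsUnit P →
      ∃ X : Fin 3 → ZMod 2, X ≠ 0 ∧ X ⬝ᵥ P.mulVec X = 0) := by
  exact ⟨det_one_add_combination, finrank_span_matABC, trivialSpectrum_span_matABC,
    fun W hW => eq_bot_or_eq_top_of_invariant W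
      (hW _ (Submodule.subset_span (by simp)))
      (hW _ (Submodule.subset_span (by simp)))
      (hW _ (Submodule.subset_span (by simp))),
    fun P _ => exists_isotropic_vector P⟩
end
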